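/- arXiv:math/0703643 — 3 statements merged into one kernel-verified Lean document; each statement's English description precedes it below -/
import Mathlib

section
/- Let R be a commutative ring, C a semidualizing R-module, and M, N R-modules both belonging to the Bass class B_C. Then for every i ≥ 0 there is an isomorphism Ext^i_R(M,N) ≅ Ext^i_R(Hom_R(C,M), Hom_R(C,N)). -/
open TensorProduct CategoryTheory

noncomputable section

/-- The natural evaluation map `ν_M : C ⊗_R Hom_R(C,M) → M`, `c ⊗ f ↦ f c`. -/
def evalNu (R : Type) [CommRing R] (C : Type) [AddCommGroup C] [Module R C]
    (M : Type) [AddCommGroup M] [Module R M] :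
    (C ⊗[R] (C →ₗ[R] M)) →ₗ[R] M :=
  TensorProduct.lift LinearMap.applyₗ

/-- The natural map `μ_M : M → Hom_R(C, C ⊗_R M)`, `m ↦ (c ↦ c ⊗ m)`. -/
def muMap (R : Type) [CommRing R] (C : Type) [AddCommGroup C] [Module R C]
    (M : Type) [AddCommGroup M] [Module R M] :
    M →ₗ[R] (C →ₗ[R] (C ⊗[R] M)) :=
  (TensorProduct.mk R C M).flip

/-- `Ext^i_R(A,B)`. -/
def extMod (R : Type) [CommRing R] (A : Type) [AddCommGroup A] [Module R A]
    (B : Type) [AddCommGroup B] [Module R B] (i : ℕ) : ModuleCat R :=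
  ((Ext R (ModuleCat R) i).obj (Opposite.op (ModuleCat.of R A))).obj (ModuleCat.of R B)

/-- `Tor_i^R(A,B)`. -/
def torMod (R : Type) [CommRing R] (A : Type) [AddCommGroup A] [Module R A]
    (B : Type) [AddCommGroup B] [Module R B] (i : ℕ) : ModuleCat R :=
  ((Tor (ModuleCat R) i).obj (ModuleCat.of R A)).obj (ModuleCat.of R B)

/-- A semidualizing module: `C` admits a degreewise finite projective resolution,
the homothety map `R → Hom_R(C,C)` is bijective, and `Ext^i_R(C,C) = 0` for `i ≥ 1`. -/
def IsSemidualizing (R : Type) [CommRing R] (C : Type) [AddCommGroup C] [Module R C] :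
    Prop :=
  (∃ (P : ℕ → ModuleCat.{0} R) (d : ∀ n, ↥(P (n + 1)) →ₗ[R] ↥(P n)) (ε : ↥(P 0) →ₗ[R] C),
      (∀ n, Module.Finite R ↥(P n)) ∧ (∀ n, Module.Projective R ↥(P n)) ∧
      Function.Surjective ε ∧ Function.Exact (d 0) ε ∧
      ∀ n, Function.Exact (d (n + 1)) (d n)) ∧
  Function.Bijective (fun r : R => (r • LinearMap.id : C →ₗ[R] C)) ∧
  ∀ i : ℕ, 1 ≤ i → Subsingleton (extMod R C C i)

/-- The Bass class `B_C`. -/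
def MemBassClass (R : Type) [CommRing R] (C : Type) [AddCommGroup C] [Module R C]
    (M : Type) [AddCommGroup M] [Module R M] : Prop :=
  (∀ i : ℕ, 1 ≤ i → Subsingleton (extMod R C M i)) ∧
  (∀ i : ℕ, 1 ≤ i → Subsingleton (torMod R C (C →ₗ[R] M) i)) ∧
  Function.Bijective (evalNu R C M)

/-- The Auslander class `A_C`. -/
def MemAuslanderClass (R : Type) [CommRing R] (C : Type) [AddCommGroup C] [Module R C]
    (M : Type) [AddCommGroup M] [Module R M] : Prop :=
  (∀ i : ℕ, 1 ≤ i → Subsingleton (torMod R C M i)) ∧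
  (∀ i : ℕ, 1 ≤ i → Subsingleton (extMod R C (C ⊗[R] M) i)) ∧
  Function.Bijective (muMap R C M)

/-- `X⁺ : ⋯ → C ⊗ P₁ → C ⊗ P₀ → M → 0` is an augmented proper `P_C`-projective resolution:
each `Pᵢ` is projective, it is a complex, and `Hom_R(C ⊗ Q, X⁺)` is exact for each
projective module `Q`. -/
def IsAugProperRes (R : Type) [CommRing R] (C : Type) [AddCommGroup C] [Module R C]
    (M : Type) [AddCommGroup M] [Module R M] (P : ℕ → ModuleCat.{0} R)
    (d : ∀ n : ℕ, (C ⊗[R] ↥(P (n + 1))) →ₗ[R] (C ⊗[R] ↥(P n)))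
    (ε : (C ⊗[R] ↥(P 0)) →ₗ[R] M) : Prop :=
  (∀ n, Module.Projective R ↥(P n)) ∧
  (∀ n, (d n).comp (d (n + 1)) = 0) ∧ (ε.comp (d 0) = 0) ∧
  ∀ (Q : Type) [AddCommGroup Q] [Module R Q], Module.Projective R Q →
    Function.Surjective (fun g : (C ⊗[R] Q) →ₗ[R] (C ⊗[R] ↥(P 0)) => ε.comp g) ∧
    Function.Exact (fun g : (C ⊗[R] Q) →ₗ[R] (C ⊗[R] ↥(P 1)) => (d 0).comp g)
      (fun g : (C ⊗[R] Q) →ₗ[R] (C ⊗[R] ↥(P 0)) => ε.comp g) ∧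
    ∀ n : ℕ, Function.Exact
      (fun g : (C ⊗[R] Q) →ₗ[R] (C ⊗[R] ↥(P (n + 2))) => (d (n + 1)).comp g)
      (fun g : (C ⊗[R] Q) →ₗ[R] (C ⊗[R] ↥(P (n + 1))) => (d n).comp g)

/-- Exactness of the augmented complex `⋯ → C ⊗ P₁ → C ⊗ P₀ → M → 0`. -/
def ResExact (R : Type) [CommRing R] (C : Type) [AddCommGroup C] [Module R C]
    (M : Type) [AddCommGroup M] [Module R M] (P : ℕ → ModuleCat.{0} R)
    (d : ∀ n : ℕ, (C ⊗[R] ↥(P (n + 1))) →ₗ[R] (C ⊗[R] ↥(P n)))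
    (ε : (C ⊗[R] ↥(P 0)) →ₗ[R] M) : Prop :=
  Function.Surjective ε ∧ Function.Exact (d 0) ε ∧
    ∀ n : ℕ, Function.Exact (d (n + 1)) (d n)

/-- Exactness of the augmented complex in all degrees `< n`
(`C ⊗ Pᵢ` in degree `i`, `M` in degree `-1`). -/
def ResExactLT (R : Type) [CommRing R] (C : Type) [AddCommGroup C] [Module R C]
    (M : Type) [AddCommGroup M] [Module R M] (P : ℕ → ModuleCat.{0} R)
    (d : ∀ n : ℕ, (C ⊗[R] ↥(P (n + 1))) →ₗ[R] (C ⊗[R] ↥(P n)))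
    (ε : (C ⊗[R] ↥(P 0)) →ₗ[R] M) (n : ℕ) : Prop :=
  Function.Surjective ε ∧ (0 < n → Function.Exact (d 0) ε) ∧
    ∀ i : ℕ, i + 1 < n → Function.Exact (d (i + 1)) (d i)


/-- An exact sequence `0 → C ⊗ P_n → ⋯ → C ⊗ P_1 → C ⊗ P_0 → M → 0`
with each `P_i` projective (encoded by an `ℕ`-indexed complex which vanishes
in degrees `> n`). -/
def HasBoundedExactCRes (R : Type) [CommRing R] (C : Type) [AddCommGroup C] [Module R C]
    (M : Type) [AddCommGroup M] [Module R M] (n : ℕ) : Prop :=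
  ∃ (P : ℕ → ModuleCat.{0} R)
    (d : ∀ i : ℕ, (C ⊗[R] ↥(P (i + 1))) →ₗ[R] (C ⊗[R] ↥(P i)))
    (ε : (C ⊗[R] ↥(P 0)) →ₗ[R] M),
      (∀ i, Module.Projective R ↥(P i)) ∧ ResExact R C M P d ε ∧
      ∀ i, n < i → Subsingleton (C ⊗[R] ↥(P i))

/-- `M` has finite `P_C`-projective dimension. -/
def HasFinCPd (R : Type) [CommRing R] (C : Type) [AddCommGroup C] [Module R C]
    (M : Type) [AddCommGroup M] [Module R M] : Prop :=
  ∃ n : ℕ, HasBoundedExactCRes R C M n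

/-- `M` has projective dimension at most `n`: there is an exact sequence
`0 → Q_n → ⋯ → Q_0 → M → 0` with each `Q_i` projective. -/
def HasProjDimLE (R : Type) [CommRing R] (M : Type) [AddCommGroup M] [Module R M]
    (n : ℕ) : Prop :=
  ∃ (Q : ℕ → ModuleCat.{0} R) (d : ∀ i : ℕ, ↥(Q (i + 1)) →ₗ[R] ↥(Q i))
    (ε : ↥(Q 0) →ₗ[R] M),
      (∀ i, Module.Projective R ↥(Q i)) ∧ Function.Surjective ε ∧
      Function.Exact (d 0) ε ∧ (∀ i, Function.Exact (d (i + 1)) (d i)) ∧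
      ∀ i, n < i → Subsingleton ↥(Q i)

/-- `M` has injective dimension at most `n`: there is an exact sequence
`0 → M → I⁰ → ⋯ → Iⁿ → 0` with each `I^j` injective. -/
def HasInjDimLE (R : Type) [CommRing R] (M : Type) [AddCommGroup M] [Module R M]
    (n : ℕ) : Prop :=
  ∃ (I : ℕ → ModuleCat.{0} R) (δ : ∀ j : ℕ, ↥(I j) →ₗ[R] ↥(I (j + 1)))
    (ι : M →ₗ[R] ↥(I 0)),
      (∀ j, Module.Injective R ↥(I j)) ∧ Function.Injective ι ∧
      Function.Exact ι (δ 0) ∧ (∀ j, Function.Exact (δ j) (δ (j + 1))) ∧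
      ∀ j, n < j → Subsingleton ↥(I j)

section Helpers

variable {R : Type} [CommRing R]

/-- Concrete cohomology `ker g / im f`. -/
abbrev HqMod {A B D : Type} [AddCommGroup A] [AddCommGroup B] [AddCommGroup D]
    [Module R A] [Module R B] [Module R D] (f : A →ₗ[R] B) (g : B →ₗ[R] D) : Type :=
  LinearMap.ker g ⧸ (LinearMap.range f).comap (LinearMap.ker g).subtype

/-- The short exact sequence `0 → ker g → X → M → 0`. -/
lemma kerShortExact {X M : Type} [AddCommGroup X] [AddCommGroup M] [Module R X] [Module R M]
    (g : X →ₗ[R] M) (hg : Function.Surjective g) :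
    (ShortComplex.moduleCatMk (LinearMap.ker g).subtype g
      (by ext x; exact x.2)).ShortExact :=
  ModuleCat.shortComplex_shortExact _
    (LinearMap.exact_subtype_ker_map g)
    (LinearMap.ker g).injective_subtype hg

/-- Dimension shifting. -/
lemma ext_shift (N : ModuleCat.{0} R) {X M : Type} [AddCommGroup X] [AddCommGroup M] [Module R X]
    [Module R M] (g : X →ₗ[R] M) (hg : Function.Surjective g) (i : ℕ)
    (h1 : Subsingleton (Abelian.Ext (ModuleCat.of R X) N (i + 1)))
    (h2 : Subsingleton (Abelian.Ext (ModuleCat.of R X) N (i + 2))) :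
    Nonempty (Abelian.Ext (ModuleCat.of R (LinearMap.ker g)) N (i + 1) ≃ₗ[R]
      Abelian.Ext (ModuleCat.of R M) N (i + 2)) := by
  have hS := kerShortExact g hg
  refine ⟨LinearEquiv.ofBijective
    (hS.extClass.precompOfLinear R N (show 1 + (i + 1) = i + 2 by omega)) ⟨?_, ?_⟩⟩
  · rw [injective_iff_map_eq_zero]
    intro x hx
    obtain ⟨y, hy⟩ := Abelian.Ext.contravariant_sequence_exact₁ hS N x
      (show 1 + (i + 1) = i + 2 by omega) hx
    have : y = 0 := @Subsingleton.elim _ h1 _ _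
    rw [← hy, this]; simp
  · intro x
    obtain ⟨y, hy⟩ := Abelian.Ext.contravariant_sequence_exact₃ hS N x
      (@Subsingleton.elim _ h2 _ _) (show 1 + (i + 1) = i + 2 by omega)
    exact ⟨y, hy⟩

/-- First `Ext` as a cokernel, categorical version. -/
lemma ext_one_cat (N : ModuleCat.{0} R) (S : ShortComplex (ModuleCat.{0} R)) (hS : S.ShortExact)
    (h1 : Subsingleton (Abelian.Ext S.X₂ N 1)) :
    ∃ φ : (S.X₁ ⟶ N) →ₗ[R] Abelian.Ext S.X₃ N 1,
      Function.Surjective φ ∧ ∀ f, φ f = 0 ↔ ∃ h : S.X₂ ⟶ N, S.f ≫ h = f := by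
  refine ⟨(hS.extClass.precompOfLinear R N (show 1 + 0 = 1 by omega)) ∘ₗ
    (Abelian.Ext.linearEquiv₀ (R := R)).symm.toLinearMap, ?_, ?_⟩
  · intro x
    obtain ⟨y, hy⟩ := Abelian.Ext.contravariant_sequence_exact₃ hS N x
      (Subsingleton.elim _ _) (show 1 + 0 = 1 by omega)
    obtain ⟨y, rfl⟩ := (Abelian.Ext.linearEquiv₀ (R := R)).symm.surjective y
    exact ⟨y, hy⟩
  · intro f
    constructor
    · intro hx
      obtain ⟨y, hy⟩ := Abelian.Ext.contravariant_sequence_exact₁ hS N (Abelian.Ext.mk₀ f)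
        (show 1 + 0 = 1 by omega) hx
      obtain ⟨h, rfl⟩ := (Abelian.Ext.linearEquiv₀ (R := R)).symm.surjective y
      refine ⟨h, ?_⟩
      rw [Abelian.Ext.linearEquiv₀_symm_apply] at hy
      exact (Abelian.Ext.mk₀_bijective _ _).1 ((Abelian.Ext.mk₀_comp_mk₀ _ _).symm.trans hy)
    · rintro ⟨h, rfl⟩
      change hS.extClass.comp (Abelian.Ext.mk₀ (S.f ≫ h)) (show 1 + 0 = 1 by omega) = 0
      rw [← Abelian.Ext.mk₀_comp_mk₀]
      exact hS.extClass_comp_assoc _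

/-- First `Ext` as a cokernel. -/
lemma ext_one (N : ModuleCat.{0} R) {X M : Type} [AddCommGroup X] [AddCommGroup M] [Module R X]
    [Module R M] (g : X →ₗ[R] M) (hg : Function.Surjective g)
    (h1 : Subsingleton (Abelian.Ext (ModuleCat.of R X) N 1)) :
    ∃ φ : (LinearMap.ker g →ₗ[R] N) →ₗ[R] Abelian.Ext (ModuleCat.of R M) N 1,
      Function.Surjective φ ∧ ∀ f, φ f = 0 ↔ ∃ h : X →ₗ[R] N, h ∘ₗ (LinearMap.ker g).subtype = f := by
  obtain ⟨φ, hφ, hφ0⟩ := ext_one_cat N _ (kerShortExact g hg) h1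
  let e : (LinearMap.ker g →ₗ[R] N) ≃ₗ[R] (ModuleCat.of R (LinearMap.ker g) ⟶ N) :=
    (ModuleCat.homLinearEquiv (S := R) (M := ModuleCat.of R (LinearMap.ker g)) (N := N)).symm
  refine ⟨φ ∘ₗ e.toLinearMap, hφ.comp e.surjective, fun f => (hφ0 (e f)).trans ⟨?_, ?_⟩⟩
  · rintro ⟨h, hh⟩
    exact ⟨h.hom, congrArg ModuleCat.Hom.hom hh⟩
  · rintro ⟨h, rfl⟩
    exact ⟨ModuleCat.ofHom h, rfl⟩

/-- Augmented exactness. -/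
def IsResn {M : Type} [AddCommGroup M] [Module R M] (X : ℕ → ModuleCat.{0} R)
    (d : ∀ n, ↥(X (n + 1)) →ₗ[R] ↥(X n)) (ε : ↥(X 0) →ₗ[R] M) : Prop :=
  Function.Surjective ε ∧ Function.Exact (d 0) ε ∧ ∀ n, Function.Exact (d (n + 1)) (d n)

/-- Precomposition with a differential. -/
abbrev preD (N : ModuleCat.{0} R) (X : ℕ → ModuleCat.{0} R)
    (d : ∀ n, ↥(X (n + 1)) →ₗ[R] ↥(X n)) (n : ℕ) :
    (↥(X n) →ₗ[R] N) →ₗ[R] (↥(X (n + 1)) →ₗ[R] N) := LinearMap.lcomp R N (d n)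

/-- Acyclic resolutions compute `Ext`. -/
theorem ext_of_acyclic (N : ModuleCat.{0} R) (i : ℕ) :
    ∀ {M : Type} [AddCommGroup M] [Module R M] (X : ℕ → ModuleCat.{0} R)
    (d : ∀ n, ↥(X (n + 1)) →ₗ[R] ↥(X n)) (ε : ↥(X 0) →ₗ[R] M) (_ : IsResn X d ε)
    (_ : ∀ n j, Subsingleton (Abelian.Ext (X n) N (j + 1))),
    Nonempty (Abelian.Ext (ModuleCat.of R M) N (i + 1) ≃ₗ[R]
      HqMod (preD N X d i) (preD N X d (i + 1))) := by
  induction i with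
  | zero =>
    intro M _ _ X d ε hX hac
    obtain ⟨hε, h0, hd⟩ := hX
    obtain ⟨φ, hφ, hφ0⟩ := ext_one N ε hε (hac 0 0)
    let d' : ↥(X 1) →ₗ[R] LinearMap.ker ε := (d 0).codRestrict _ (fun x => h0.apply_apply_eq_zero x)
    have hd' : Function.Surjective d' := by
      rintro ⟨x, hx⟩
      obtain ⟨y, rfl⟩ := (h0 x).1 hx
      exact ⟨y, rfl⟩
    let ψ : (LinearMap.ker ε →ₗ[R] N) →ₗ[R] LinearMap.ker (preD N X d 1) :=
      (LinearMap.lcomp R N d').codRestrict _ (by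
        intro f
        ext x
        have : d' (d 1 x) = 0 := Subtype.ext ((hd 0).apply_apply_eq_zero x)
        simp [this])
    have hψ : Function.Bijective ψ := by
      constructor
      · intro f g hfg
        ext x
        obtain ⟨y, rfl⟩ := hd' x
        exact LinearMap.congr_fun (congrArg Subtype.val hfg) y
      · rintro ⟨f, hf⟩
        have hk : LinearMap.ker d' ≤ LinearMap.ker f := by
          intro x hx
          obtain ⟨y, rfl⟩ := (hd 0 x).1 (congrArg Subtype.val hx)
          exact LinearMap.congr_fun hf y
        refine ⟨(LinearMap.ker d').liftQ f hk ∘ₗ (d'.quotKerEquivOfSurjective hd').symm, ?_⟩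
        apply Subtype.ext
        ext x
        change (LinearMap.ker d').liftQ f hk ((d'.quotKerEquivOfSurjective hd').symm (d' x)) = f x
        have : (d'.quotKerEquivOfSurjective hd').symm (d' x) = (LinearMap.ker d').mkQ x := by
          rw [LinearEquiv.symm_apply_eq]; rfl
        rw [this]; simp
    let ψe := LinearEquiv.ofBijective ψ hψ
    let χ := φ ∘ₗ ψe.symm.toLinearMap
    have hχ : Function.Surjective χ := hφ.comp ψe.symm.surjective
    have hker : LinearMap.ker χ =
        (LinearMap.range (preD N X d 0)).comap (LinearMap.ker (preD N X d 1)).subtype := by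
      ext f
      obtain ⟨f, rfl⟩ := ψe.surjective f
      have : χ (ψe f) = φ f := by simp [χ]
      rw [LinearMap.mem_ker, this, hφ0, Submodule.mem_comap, LinearMap.mem_range]
      constructor
      · rintro ⟨h, rfl⟩
        exact ⟨h, rfl⟩
      · rintro ⟨h, hh⟩
        refine ⟨h, ?_⟩
        ext x
        obtain ⟨y, rfl⟩ := hd' x
        exact LinearMap.congr_fun hh y
    exact ⟨(χ.quotKerEquivOfSurjective hχ).symm ≪≫ₗ Submodule.quotEquivOfEq _ _ hker⟩
  | succ i ih =>
    intro M _ _ X d ε hX hac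
    obtain ⟨hε, h0, hd⟩ := hX
    obtain ⟨e⟩ := ext_shift N ε hε i (hac 0 i) (hac 0 (i + 1))
    let d' : ↥(X 1) →ₗ[R] LinearMap.ker ε := (d 0).codRestrict _ (fun x => h0.apply_apply_eq_zero x)
    obtain ⟨eB⟩ := ih (M := LinearMap.ker ε) (fun n => X (n + 1)) (fun n => d (n + 1)) d' (by
      refine ⟨?_, ?_, fun n => hd (n + 1)⟩
      · rintro ⟨x, hx⟩
        obtain ⟨y, rfl⟩ := (h0 x).1 hx
        exact ⟨y, rfl⟩
      · intro x
        rw [← hd 0 x]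
        exact Subtype.ext_iff) (fun n j => hac (n + 1) j)
    exact ⟨e.symm ≪≫ₗ eB⟩

/-- Isomorphic concrete cohomology. -/
lemma hqMod_congr {A B D A' B' D' : Type} [AddCommGroup A] [AddCommGroup B] [AddCommGroup D]
    [Module R A] [Module R B] [Module R D] [AddCommGroup A'] [AddCommGroup B'] [AddCommGroup D']
    [Module R A'] [Module R B'] [Module R D'] (f : A →ₗ[R] B) (g : B →ₗ[R] D)
    (f' : A' →ₗ[R] B') (g' : B' →ₗ[R] D') (a : A ≃ₗ[R] A') (b : B ≃ₗ[R] B') (c : D ≃ₗ[R] D')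
    (hf : ∀ x, b (f x) = f' (a x)) (hg : ∀ x, c (g x) = g' (b x)) :
    Nonempty (HqMod f g ≃ₗ[R] HqMod f' g') := by
  have hk : (LinearMap.ker g).map b.toLinearMap = LinearMap.ker g' := by
    ext y
    obtain ⟨x, rfl⟩ := b.surjective y
    rw [LinearMap.mem_ker, ← hg]
    simp
  refine ⟨Submodule.Quotient.equiv _ _ (b.ofSubmodules _ _ hk) ?_⟩
  ext y
  obtain ⟨y, rfl⟩ := (b.ofSubmodules _ _ hk).surjective y
  have h1 : y.1 ∈ LinearMap.range f ↔ b y.1 ∈ LinearMap.range f' := by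
    constructor
    · rintro ⟨x, hx⟩
      exact ⟨a x, by rw [← hf, hx]⟩
    · rintro ⟨x, hx⟩
      obtain ⟨x, rfl⟩ := a.surjective x
      exact ⟨x, b.injective (by rw [hf, hx])⟩
  constructor
  · rintro ⟨z, hz, hzy⟩
    obtain rfl := (b.ofSubmodules _ _ hk).injective hzy
    exact h1.1 hz
  · intro h
    exact ⟨y, h1.2 h, rfl⟩

/-- Homology of a short complex of modules. -/
lemma homology_hqMod (S : ShortComplex (ModuleCat.{0} R)) :
    Nonempty (S.homology ≃ₗ[R] HqMod S.f.hom S.g.hom) := by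
  refine ⟨S.moduleCatHomologyIso.toLinearEquiv ≪≫ₗ Submodule.quotEquivOfEq _ _ ?_⟩
  ext x
  simp only [LinearMap.mem_range, Submodule.mem_comap]
  exact exists_congr fun y => Subtype.ext_iff

/-- The differentials of a projective resolution as linear maps. -/
abbrev resD {A : ModuleCat.{0} R} (P : ProjectiveResolution A) (n : ℕ) :
    P.complex.X (n + 1) →ₗ[R] P.complex.X n := (P.complex.d (n + 1) n).hom

/-- The augmentation. -/
abbrev resE {A : ModuleCat.{0} R} (P : ProjectiveResolution A) :
    P.complex.X 0 →ₗ[R] A := (P.π.f 0).hom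

lemma isResn_res {A : ModuleCat.{0} R} (P : ProjectiveResolution A) :
    IsResn P.complex.X (resD P) (resE P) := by
  refine ⟨(ModuleCat.epi_iff_surjective (P.π.f 0)).1 inferInstance, ?_, fun n => ?_⟩
  · exact (ShortComplex.ShortExact.moduleCat_exact_iff_function_exact _).1 P.exact₀
  · exact (ShortComplex.ShortExact.moduleCat_exact_iff_function_exact _).1 (P.exact_succ n)

lemma extMod_succ (A N : Type) [AddCommGroup A] [Module R A] [AddCommGroup N] [Module R N]
    (P : ProjectiveResolution (ModuleCat.of R A)) (i : ℕ) :
    Nonempty (extMod R A N (i + 1) ≃ₗ[R]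
      HqMod (preD (ModuleCat.of R N) P.complex.X (resD P) i)
        (preD (ModuleCat.of R N) P.complex.X (resD P) (i + 1))) := by
  let K := P.complex.linearYonedaObj R (ModuleCat.of R N)
  let e1 : extMod R A N (i + 1) ≅ K.homology (i + 1) := P.isoExt (i + 1) (ModuleCat.of R N)
  let e2 := K.homologyIsoSc' i (i + 1) (i + 2) (by simp) (by simp)
  obtain ⟨e3⟩ := homology_hqMod (K.sc' i (i + 1) (i + 2))
  obtain ⟨e4⟩ := hqMod_congr (K.sc' i (i + 1) (i + 2)).f.hom (K.sc' i (i + 1) (i + 2)).g.hom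
    (preD (ModuleCat.of R N) P.complex.X (resD P) i)
    (preD (ModuleCat.of R N) P.complex.X (resD P) (i + 1))
    (ModuleCat.homLinearEquiv (S := R)) (ModuleCat.homLinearEquiv (S := R))
    (ModuleCat.homLinearEquiv (S := R)) (fun x => rfl) (fun x => rfl)
  exact ⟨e1.toLinearEquiv ≪≫ₗ e2.toLinearEquiv ≪≫ₗ e3 ≪≫ₗ e4⟩

/-- `Hom(A,N)` as a kernel. -/
lemma hom_equiv_ker {A X Y N : Type} [AddCommGroup A] [Module R A] [AddCommGroup N] [Module R N]
    [AddCommGroup X] [Module R X] [AddCommGroup Y] [Module R Y] (ε : X →ₗ[R] A) (d : Y →ₗ[R] X)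
    (hε : Function.Surjective ε) (h0 : Function.Exact d ε) :
    Nonempty ((A →ₗ[R] N) ≃ₗ[R] LinearMap.ker (LinearMap.lcomp R N d)) := by
  let ψ : (A →ₗ[R] N) →ₗ[R] LinearMap.ker (LinearMap.lcomp R N d) :=
    (LinearMap.lcomp R N ε).codRestrict _ (by
      intro f
      ext x
      simp [h0.apply_apply_eq_zero x])
  refine ⟨LinearEquiv.ofBijective ψ ⟨?_, ?_⟩⟩
  · intro f g hfg
    ext x
    obtain ⟨y, rfl⟩ := hε x
    exact LinearMap.congr_fun (congrArg Subtype.val hfg) y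
  · rintro ⟨f, hf⟩
    have hk : LinearMap.ker ε ≤ LinearMap.ker f := by
      intro x hx
      obtain ⟨y, rfl⟩ := (h0 x).1 hx
      exact LinearMap.congr_fun hf y
    refine ⟨(LinearMap.ker ε).liftQ f hk ∘ₗ (ε.quotKerEquivOfSurjective hε).symm, ?_⟩
    apply Subtype.ext
    ext x
    change (LinearMap.ker ε).liftQ f hk ((ε.quotKerEquivOfSurjective hε).symm (ε x)) = f x
    have : (ε.quotKerEquivOfSurjective hε).symm (ε x) = (LinearMap.ker ε).mkQ x := by
      rw [LinearEquiv.symm_apply_eq]; rfl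
    rw [this]; simp

lemma extMod_zero (A N : Type) [AddCommGroup A] [Module R A] [AddCommGroup N] [Module R N] :
    Nonempty (extMod R A N 0 ≃ₗ[R] (A →ₗ[R] N)) := by
  let P := projectiveResolution (ModuleCat.of R A)
  let K := P.complex.linearYonedaObj R (ModuleCat.of R N)
  let e1 : extMod R A N 0 ≅ K.homology 0 := P.isoExt 0 (ModuleCat.of R N)
  let e2 := K.homologyIsoSc' 0 0 1 (by simp) (by simp)
  obtain ⟨e3⟩ := homology_hqMod (K.sc' 0 0 1)
  have hz : (K.sc' 0 0 1).f.hom = 0 := by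
    have : (K.sc' 0 0 1).f = 0 := K.shape 0 0 (by simp)
    rw [this]; rfl
  obtain ⟨e4⟩ := hqMod_congr (K.sc' 0 0 1).f.hom (K.sc' 0 0 1).g.hom
    (0 : (P.complex.X 0 →ₗ[R] N) →ₗ[R] (P.complex.X 0 →ₗ[R] N))
    (preD (ModuleCat.of R N) P.complex.X (resD P) 0)
    (ModuleCat.homLinearEquiv (S := R)) (ModuleCat.homLinearEquiv (S := R))
    (ModuleCat.homLinearEquiv (S := R)) (fun x => by rw [hz]; rfl) (fun x => rfl)
  obtain ⟨h1, h2, -⟩ := isResn_res P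
  obtain ⟨e6⟩ := hom_equiv_ker (N := N) (resE P) (resD P 0) h1 h2
  let e5 := Submodule.quotEquivOfEqBot ((LinearMap.range
    (0 : (P.complex.X 0 →ₗ[R] N) →ₗ[R] (P.complex.X 0 →ₗ[R] N))).comap
      (LinearMap.ker (preD (ModuleCat.of R N) P.complex.X (resD P) 0)).subtype) (by simp)
  exact ⟨e1.toLinearEquiv ≪≫ₗ e2.toLinearEquiv ≪≫ₗ e3 ≪≫ₗ e4 ≪≫ₗ e5 ≪≫ₗ e6.symm⟩

/-- Comparison of the two `Ext`. -/
lemma extMod_absExt (A N : Type) [AddCommGroup A] [Module R A] [AddCommGroup N] [Module R N]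
    (i : ℕ) : Nonempty (extMod R A N (i + 1) ≃ₗ[R]
      Abelian.Ext (ModuleCat.of R A) (ModuleCat.of R N) (i + 1)) := by
  let P := projectiveResolution (ModuleCat.of R A)
  obtain ⟨e⟩ := extMod_succ A N P i
  obtain ⟨eB⟩ := ext_of_acyclic (ModuleCat.of R N) i P.complex.X (resD P) (resE P) (isResn_res P)
    (fun n j => Abelian.Ext.subsingleton_of_projective _ _ _)
  exact ⟨e ≪≫ₗ eB.symm⟩

/-- `C ⊗ F` is acyclic when `C` is and `F` is projective. -/
lemma tensor_acyclic (C F N : Type) [AddCommGroup C] [Module R C] [AddCommGroup N] [Module R N]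
    [AddCommGroup F] [Module R F] [Module.Projective R F]
    (h : ∀ i : ℕ, 1 ≤ i → Subsingleton (extMod R C N i)) (i : ℕ) :
    Subsingleton (Abelian.Ext (ModuleCat.of R (C ⊗[R] F)) (ModuleCat.of R N) (i + 1)) := by
  let P := projectiveResolution (ModuleCat.of R C)
  obtain ⟨e⟩ := extMod_succ C N P i
  have hP : ∀ n, Module.Projective R (P.complex.X n) := fun n =>
    (IsProjective.iff_projective _).2 (P.projective n)
  obtain ⟨h1, h2, h3⟩ := isResn_res P
  obtain ⟨eB⟩ := ext_of_acyclic (ModuleCat.of R N) i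
    (fun n => ModuleCat.of R (P.complex.X n ⊗[R] F)) (fun n => (resD P n).rTensor F)
    ((resE P).rTensor F)
    ⟨LinearMap.rTensor_surjective _ h1, rTensor_exact F h2 h1,
      fun n => Module.Flat.rTensor_exact F (h3 n)⟩
    (fun n j => by
      have : Projective (ModuleCat.of R (P.complex.X n ⊗[R] F)) :=
        (IsProjective.iff_projective _).1 inferInstance
      exact Abelian.Ext.subsingleton_of_projective _ _ _)
  have hs := h (i + 1) (by omega)
  have hs' := e.symm.toEquiv.subsingleton
  refine @Equiv.subsingleton _ _ eB.toEquiv ?_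
  rw [Submodule.Quotient.subsingleton_iff] at hs' ⊢
  rw [eq_top_iff]
  rintro ⟨f, hf⟩ -
  let f' : F →ₗ[R] P.complex.X (i + 1) →ₗ[R] N := (TensorProduct.curry f).flip
  let g := preD (ModuleCat.of R N) P.complex.X (resD P) i
  have hf' : ∀ x, f' x ∈ LinearMap.range g := by
    intro x
    have hx : f' x ∈ LinearMap.ker (preD (ModuleCat.of R N) P.complex.X (resD P) (i + 1)) := by
      rw [LinearMap.mem_ker]
      ext y
      exact LinearMap.congr_fun hf (y ⊗ₜ[R] x)
    have : (⟨f' x, hx⟩ : LinearMap.ker _) ∈ (⊤ : Submodule R _) := trivial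
    rw [← hs'] at this
    exact this
  obtain ⟨k, hk⟩ := Module.projective_lifting_property g.rangeRestrict
    (f'.codRestrict _ hf') g.surjective_rangeRestrict
  refine ⟨TensorProduct.lift k.flip, ?_⟩
  apply TensorProduct.ext'
  intro y x
  have := congrArg Subtype.val (LinearMap.congr_fun hk x)
  exact LinearMap.congr_fun this y

/-- Vanishing of `Tor` gives exactness. -/
lemma tor_exact (C H : Type) [AddCommGroup C] [Module R C] [AddCommGroup H] [Module R H]
    (P : ProjectiveResolution (ModuleCat.of R H))
    (h : ∀ i : ℕ, 1 ≤ i → Subsingleton (torMod R C H i)) (n : ℕ) :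
    Function.Exact ((resD P (n + 1)).lTensor C) ((resD P n).lTensor C) := by
  let F := (MonoidalCategory.tensoringLeft (ModuleCat.{0} R)).obj (ModuleCat.of R C)
  let K := (F.mapHomologicalComplex (ComplexShape.down ℕ)).obj P.complex
  let e : torMod R C H (n + 1) ≅ K.homology (n + 1) := P.isoLeftDerivedObj F (n + 1)
  have hs := h (n + 1) (by omega)
  have hz : Limits.IsZero (K.homology (n + 1)) :=
    (ModuleCat.isZero_of_subsingleton (torMod R C H (n + 1))).of_iso e.symm
  rw [← HomologicalComplex.exactAt_iff_isZero_homology,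
    K.exactAt_iff' (n + 2) (n + 1) n (by simp) (by simp)] at hz
  exact (ShortComplex.ShortExact.moduleCat_exact_iff_function_exact _).1 hz

/-- Tensor-hom adjunction in the order we need. -/
def adjEquiv (C F N : Type) [AddCommGroup C] [Module R C] [AddCommGroup N] [Module R N]
    [AddCommGroup F] [Module R F] : ((C ⊗[R] F) →ₗ[R] N) ≃ₗ[R] (F →ₗ[R] C →ₗ[R] N) :=
  (TensorProduct.lift.equiv (RingHom.id R) C F N).symm ≪≫ₗ LinearMap.lflip

end Helpers

/-- If `M` and `N` are in the Bass class `B_C`, then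
`Ext^i_R(M,N) ≅ Ext^i_R(Hom_R(C,M), Hom_R(C,N))` for all `i`. -/
theorem absExt_iso_homExt_of_bassClass
    (R : Type) [CommRing R] (C : Type) [AddCommGroup C] [Module R C]
    (M : Type) [AddCommGroup M] [Module R M]
    (N : Type) [AddCommGroup N] [Module R N] (hC : IsSemidualizing R C)
    (hM : MemBassClass R C M) (hN : MemBassClass R C N) :
    ∀ i : ℕ, Nonempty (↥(extMod R M N i) ≃ₗ[R]
      ↥(extMod R (C →ₗ[R] M) (C →ₗ[R] N) i)) := by
  obtain ⟨-, hT, hν⟩ := hM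
  obtain ⟨hE, -, -⟩ := hN
  let ν := LinearEquiv.ofBijective (evalNu R C M) hν
  rintro (_ | i)
  · obtain ⟨e1⟩ := extMod_zero (R := R) M N
    obtain ⟨e2⟩ := extMod_zero (R := R) (C →ₗ[R] M) (C →ₗ[R] N)
    exact ⟨e1 ≪≫ₗ LinearEquiv.arrowCongr ν.symm (LinearEquiv.refl R N) ≪≫ₗ
      adjEquiv C (C →ₗ[R] M) N ≪≫ₗ e2.symm⟩
  · let P := projectiveResolution (ModuleCat.of R (C →ₗ[R] M))
    have hP : ∀ n, Module.Projective R (P.complex.X n) := fun n =>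
      (IsProjective.iff_projective _).2 (P.projective n)
    obtain ⟨h1, h2, -⟩ := isResn_res P
    obtain ⟨e1⟩ := extMod_absExt (R := R) M N i
    obtain ⟨e2⟩ := ext_of_acyclic (ModuleCat.of R N) i
      (fun n => ModuleCat.of R (C ⊗[R] P.complex.X n)) (fun n => (resD P n).lTensor C)
      (ν.toLinearMap ∘ₗ (resE P).lTensor C)
      ⟨ν.surjective.comp (LinearMap.lTensor_surjective _ h1), by
        intro x
        rw [← lTensor_exact C h2 h1 x]
        exact ν.map_eq_zero_iff, fun n => tor_exact C _ P hT n⟩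
      (fun n j => tensor_acyclic C _ N hE j)
    obtain ⟨e3⟩ := extMod_succ (C →ₗ[R] M) (C →ₗ[R] N) P i
    obtain ⟨e4⟩ := hqMod_congr
      (preD (ModuleCat.of R N) (fun n => ModuleCat.of R (C ⊗[R] P.complex.X n))
        (fun n => (resD P n).lTensor C) i)
      (preD (ModuleCat.of R N) (fun n => ModuleCat.of R (C ⊗[R] P.complex.X n))
        (fun n => (resD P n).lTensor C) (i + 1))
      (preD (ModuleCat.of R (C →ₗ[R] N)) P.complex.X (resD P) i)
      (preD (ModuleCat.of R (C →ₗ[R] N)) P.complex.X (resD P) (i + 1))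
      (adjEquiv C _ N) (adjEquiv C _ N) (adjEquiv C _ N)
      (fun x => rfl) (fun x => rfl)
    exact ⟨e1 ≪≫ₗ e2 ≪≫ₗ e4 ≪≫ₗ e3.symm⟩

end
end

section
/- Let (R, m, k) be a commutative noetherian local ring and C a semidualizing R-module. The following are equivalent: (i) every R-module has finite P_C-projective dimension; (ii) the residue field k has finite P_C-projective dimension; (iii) R is a regular local ring. -/
open TensorProduct CategoryTheory

noncomputable section

section
/-- Projective dimension at most `n`. -/
def PdLE (R : Type) [CommRing R] (n : ℕ) (M : Type) [AddCommGroup M] [Module R M] : Prop :=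
  HasProjectiveDimensionLE (ModuleCat.of R M) n

section pd
variable {R : Type} [CommRing R] {M N K F : Type} [AddCommGroup M] [Module R M]
  [AddCommGroup N] [Module R N] [AddCommGroup K] [Module R K] [AddCommGroup F] [Module R F]

lemma pdLE_zero : PdLE R 0 M ↔ Module.Projective R M := by
  unfold PdLE
  rw [← projective_iff_hasProjectiveDimensionLE_zero]
  exact (IsProjective.iff_projective M).symm

lemma PdLE.mono {n m : ℕ} (h : n ≤ m) (hM : PdLE R n M) : PdLE R m M := by
  unfold PdLE at *
  exact hasProjectiveDimensionLT_of_ge _ (n+1) (m+1) (by omega)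

lemma pdLE_retract {n : ℕ} (i : M →ₗ[R] N) (r : N →ₗ[R] M) (h : r ∘ₗ i = LinearMap.id)
    (hN : PdLE R n N) : PdLE R n M := by
  unfold PdLE at *
  refine Retract.hasProjectiveDimensionLT (Y := ModuleCat.of R N)
    ⟨ModuleCat.ofHom i, ModuleCat.ofHom r, ?_⟩ (n+1)
  rw [← ModuleCat.ofHom_comp, h]; rfl

lemma pdLE_equiv {n : ℕ} (e : M ≃ₗ[R] N) : PdLE R n M ↔ PdLE R n N :=
  ⟨pdLE_retract e.symm.toLinearMap e.toLinearMap (by ext; simp),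
   pdLE_retract e.toLinearMap e.symm.toLinearMap (by ext; simp)⟩

lemma shortExact_of {i : K →ₗ[R] F} {f : F →ₗ[R] M}
    (hi : Function.Injective i) (hf : Function.Surjective f) (he : Function.Exact i f) :
    (ModuleCat.shortComplexOfCompEqZero i f he.linearMap_comp_eq_zero).ShortExact :=
  ModuleCat.shortComplex_shortExact _ he hi hf

lemma pdLE_succ [Module.Projective R F] {n : ℕ} {i : K →ₗ[R] F} {f : F →ₗ[R] M}
    (hi : Function.Injective i) (hf : Function.Surjective f) (he : Function.Exact i f) :
    PdLE R (n+1) M ↔ PdLE R n K := by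
  unfold PdLE
  exact (shortExact_of hi hf he).hasProjectiveDimensionLT_X₃_iff n
    ((IsProjective.iff_projective F).mp inferInstance)

lemma pdLE_three {n : ℕ} {i : K →ₗ[R] F} {f : F →ₗ[R] M}
    (hi : Function.Injective i) (hf : Function.Surjective f) (he : Function.Exact i f)
    (hK : PdLE R n K) (hF : PdLE R (n+1) F) : PdLE R (n+1) M := by
  exact (shortExact_of hi hf he).hasProjectiveDimensionLT_X₃ (n+1) hK hF

lemma exact_ker_subtype (f : F →ₗ[R] M) : Function.Exact (LinearMap.ker f).subtype f := by
  intro y; simp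

end pd

/-- If all f.g. modules have pd at most d, then all modules do. -/
lemma pdLE_all (R : Type) [CommRing R] (d : ℕ)
    (h : ∀ (I : Ideal R), PdLE R d (R ⧸ I))
    (M : Type) [AddCommGroup M] [Module R M] : PdLE R d M := by
  -- injective dimension of every N at most d
  have key : ∀ (n : ℕ) (N : ModuleCat.{0} R),
      (∀ I : Ideal R, ∀ e : Abelian.Ext (ModuleCat.of R (R ⧸ I)) N (n+1), e = 0) →
      HasInjectiveDimensionLE N n := by
    intro n
    induction n with
    | zero =>
      intro N hN
      have : Module.Baer R N := by
        intro I g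
        have hex : Function.Exact (Submodule.subtype I) (Submodule.mkQ I) :=
          LinearMap.exact_subtype_mkQ I
        let S := ModuleCat.shortComplexOfCompEqZero _ _ hex.linearMap_comp_eq_zero
        have hS : S.ShortExact := ModuleCat.shortComplex_shortExact S
          hex (Submodule.injective_subtype I) (Submodule.mkQ_surjective I)
        obtain ⟨g', hg'⟩ := Abelian.Ext.contravariant_sequence_exact₁ hS N
          (Abelian.Ext.mk₀ (ModuleCat.ofHom g : S.X₁ ⟶ N)) (add_zero 1) (hN I _)
        obtain ⟨g'', rfl⟩ := (Abelian.Ext.mk₀_bijective _ _).2 g'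
        rw [Abelian.Ext.mk₀_comp_mk₀, (Abelian.Ext.mk₀_bijective _ _).1.eq_iff] at hg'
        refine ⟨g''.hom, fun x hx => ?_⟩
        have := congrArg (fun t => t.hom ⟨x, hx⟩) hg'
        exact this
      rw [Module.Baer.iff_injective] at this
      rw [Module.injective_iff_injective_object] at this
      exact injective_iff_hasInjectiveDimensionLT_one.mp this
    | succ n ih =>
      intro N hN
      let ⟨I, _, f, _⟩ := EnoughInjectives.presentation N
      have injf : Function.Injective f.hom := (ModuleCat.mono_iff_injective f).mp ‹_›
      let S : ShortComplex (ModuleCat.{0} R) :=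
        ModuleCat.shortComplexOfCompEqZero _ _ f.hom.exact_map_mkQ_range.linearMap_comp_eq_zero
      have hS : S.ShortExact := ModuleCat.shortComplex_shortExact S
        f.hom.exact_map_mkQ_range injf (Submodule.mkQ_surjective _)
      refine (hS.hasInjectiveDimensionLT_X₃_iff n (by assumption)).mp (ih _ ?_)
      intro J e
      obtain ⟨e', he'⟩ := Abelian.Ext.covariant_sequence_exact₃ _ hS e rfl (hN J _)
      have : Injective S.X₂ := by assumption
      rw [← he', Abelian.Ext.eq_zero_of_injective e']
      simp
  unfold PdLE
  refine hasProjectiveDimensionLT_of_enoughInjectives _ (d+1) ?_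
  intro Y
  have := key d Y (fun I e => by
    have := h I
    unfold PdLE at this
    exact e.eq_zero_of_hasProjectiveDimensionLT (d+1) le_rfl)
  exact ⟨fun a b => by
    rw [a.eq_zero_of_hasInjectiveDimensionLT (d+1) le_rfl,
      b.eq_zero_of_hasInjectiveDimensionLT (d+1) le_rfl]⟩

end

section
open IsLocalRing in
lemma exists_min_cover (R : Type) [CommRing R] [IsLocalRing R] (M : Type) [AddCommGroup M]
    [Module R M] [Module.Finite R M] :
    ∃ (ι : Type) (_ : Finite ι) (f : (ι →₀ R) →ₗ[R] M), Function.Surjective f ∧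
      ∀ a, f a = 0 → ∀ i, a i ∈ maximalIdeal R := by
  let w := Module.Free.chooseBasis (ResidueField R) (ResidueField R ⊗[R] M)
  have ⟨v, hveq⟩ := (TensorProduct.mk_surjective R M (ResidueField R)
    Ideal.Quotient.mk_surjective).comp_left w
  refine ⟨_, Module.Finite.finite_basis w, Finsupp.linearCombination R v, ?_, ?_⟩
  · rw [← LinearMap.range_eq_top, Finsupp.range_linearCombination]
    exact span_eq_top_of_tmul_eq_basis _ w (congr_fun hveq)
  · intro a ha i
    have h1 := congrArg (TensorProduct.mk R (ResidueField R) M 1) ha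
    rw [Finsupp.linearCombination_apply, Finsupp.sum, map_sum, map_zero] at h1
    have h2 : ∑ j ∈ a.support, (residue R (a j)) • w j = 0 := by
      rw [← h1]
      refine Finset.sum_congr rfl fun j _ => ?_
      rw [← congr_fun hveq j, map_smul]
      exact algebraMap_smul (ResidueField R) (a j) _
    by_cases hi : i ∈ a.support
    · have := linearIndependent_iff'.mp w.linearIndependent _ _ h2 i hi
      rwa [residue_eq_zero_iff] at this
    · rw [Finsupp.notMem_support_iff.mp hi]; exact zero_mem _

open IsLocalRing in
/-- Over a local ring with nonzero socle, finite projective dimension implies projective. -/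
lemma projective_of_socle (R : Type) [CommRing R] [IsLocalRing R] [IsNoetherianRing R] (s : R)
    (hs : s ≠ 0) (hsm : ∀ r ∈ maximalIdeal R, s * r = 0) (n : ℕ) (M : Type) [AddCommGroup M]
    [Module R M] [Module.Finite R M] (h : PdLE R n M) : Module.Projective R M := by
  induction n generalizing M with
  | zero => exact pdLE_zero.mp h
  | succ n ih =>
    obtain ⟨ι, _, f, hf, hk⟩ := exists_min_cover R M
    have h' : PdLE R n (LinearMap.ker f) :=
      (pdLE_succ (Submodule.injective_subtype _) hf (exact_ker_subtype f)).mp h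
    have hp := ih _ h'
    have : Module.Free R (LinearMap.ker f) :=
      Module.free_of_flat_of_isLocalRing (R := R) (P := LinearMap.ker f)
    have h0 : ∀ y : LinearMap.ker f, s • y = 0 := by
      rintro ⟨y, hy⟩
      ext i
      simpa using hsm _ (hk y hy i)
    have hsub : Subsingleton (LinearMap.ker f) := by
      by_contra hne
      rw [not_subsingleton_iff_nontrivial] at hne
      let b := Module.Free.chooseBasis R (LinearMap.ker f)
      obtain ⟨i⟩ := b.index_nonempty
      have := congrArg (fun t => b.repr t i) (h0 (b i))
      simp at this
      exact hs this
    have hinj : Function.Injective f := by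
      rw [← LinearMap.ker_eq_bot]; exact Submodule.subsingleton_iff_eq_bot.mp hsub
    exact Module.Projective.of_equiv (LinearEquiv.ofBijective f ⟨hinj, hf⟩)

open IsLocalRing in
lemma retract_residue (A : Type) [CommRing A] [IsLocalRing A] (W : Type) [AddCommGroup W]
    [Module A W] (w : W) (h0 : ∀ a ∈ maximalIdeal A, a • w = 0)
    (hw : w ∉ maximalIdeal A • (⊤ : Submodule A W)) :
    ∃ (i : ResidueField A →ₗ[A] W) (r : W →ₗ[A] ResidueField A), r ∘ₗ i = LinearMap.id := by
  let : Module (ResidueField A) (W ⧸ (maximalIdeal A • ⊤ : Submodule A W)) :=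
      inferInstanceAs (Module (A ⧸ maximalIdeal A) (W ⧸ maximalIdeal A • (⊤ : Submodule A W)))
  let : IsScalarTower A (ResidueField A) (W ⧸ (maximalIdeal A • ⊤ : Submodule A W)) :=
      inferInstanceAs (IsScalarTower A (A ⧸ maximalIdeal A)
        (W ⧸ maximalIdeal A • (⊤ : Submodule A W)))
  have hne : (Submodule.Quotient.mk w : W ⧸ (maximalIdeal A • ⊤ : Submodule A W)) ≠ 0 := by
    rwa [Ne, Submodule.Quotient.mk_eq_zero]
  obtain ⟨φ, hφ⟩ := Module.Projective.exists_dual_eq_one (ResidueField A) hne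
  let i : ResidueField A →ₗ[A] W := Submodule.liftQ (maximalIdeal A)
    (LinearMap.toSpanSingleton A W w) (by
      intro a ha
      simpa using h0 a ha)
  let r : W →ₗ[A] ResidueField A :=
    (φ.restrictScalars A) ∘ₗ (Submodule.mkQ (maximalIdeal A • ⊤ : Submodule A W))
  refine ⟨i, r, ?_⟩
  apply LinearMap.ext
  intro t
  obtain ⟨a, rfl⟩ := residue_surjective t
  have h1 : i (residue A a) = a • w := rfl
  have h2 : r w = 1 := hφ
  rw [LinearMap.comp_apply, h1, map_smul, h2, LinearMap.id_apply]
  rw [Algebra.smul_def, mul_one]; rfl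

section quot
variable {R : Type} [CommRing R] (x : R)

/-- The induced map on quotients, linear over `R/x`. -/
def qmap {M N : Type} [AddCommGroup M] [Module R M] [AddCommGroup N] [Module R N]
    (f : M →ₗ[R] N) : QuotSMulTop x M →ₗ[R ⧸ Ideal.span {x}] QuotSMulTop x N :=
  (QuotSMulTop.map x f).extendScalarsOfSurjective Ideal.Quotient.mk_surjective

lemma qmap_coe {M N : Type} [AddCommGroup M] [Module R M] [AddCommGroup N] [Module R N]
    (f : M →ₗ[R] N) : (qmap x f : QuotSMulTop x M → QuotSMulTop x N) = QuotSMulTop.map x f := rfl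

lemma qmap_injective {K F M : Type} [AddCommGroup M] [Module R M] [AddCommGroup F] [Module R F]
    [AddCommGroup K] [Module R K] {i : K →ₗ[R] F} {f : F →ₗ[R] M}
    (hi : Function.Injective i) (he : Function.Exact i f) (hx : IsSMulRegular M x) :
    Function.Injective (qmap x i) := by
  rw [injective_iff_map_eq_zero]
  intro a ha
  obtain ⟨a, rfl⟩ := Submodule.Quotient.mk_surjective _ a
  rw [qmap_coe, QuotSMulTop.map_apply_mk, Submodule.Quotient.mk_eq_zero,
    Submodule.mem_smul_pointwise_iff_exists] at ha
  obtain ⟨y, -, hy⟩ := ha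
  have h1 : f y = 0 := by
    apply hx
    simp only [smul_zero]
    rw [← map_smul, hy]
    exact he.apply_apply_eq_zero a
  obtain ⟨z, rfl⟩ := (he y).mp h1
  rw [← map_smul] at hy
  rw [← hi hy, Submodule.Quotient.mk_eq_zero]
  exact Submodule.smul_mem_pointwise_smul _ _ _ trivial

open IsLocalRing in
lemma pdLE_quot_iff [IsLocalRing R] [IsNoetherianRing R] (hxm : x ∈ maximalIdeal R)
    (hxR : IsSMulRegular R x) (n : ℕ) (M : Type) [AddCommGroup M] [Module R M]
    [Module.Finite R M] (hx : IsSMulRegular M x) :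
    PdLE (R ⧸ Ideal.span {x}) n (QuotSMulTop x M) ↔ PdLE R n M := by
  induction n generalizing M with
  | zero =>
    have : IsLocalRing (R ⧸ Ideal.span {x}) := by
      have : Nontrivial (R ⧸ Ideal.span {x}) := Ideal.Quotient.nontrivial_iff.mpr
        (fun h => (maximalIdeal.isMaximal R).ne_top (top_le_iff.mp (h ▸ by
          rw [Ideal.span_le]; simpa using hxm)))
      exact IsLocalRing.of_surjective' _ Ideal.Quotient.mk_surjective
    rw [pdLE_zero, pdLE_zero]
    have := Module.Finite.of_restrictScalars_finite R (R ⧸ Ideal.span {x}) (QuotSMulTop x M)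
    have := Module.finitePresentation_of_finite R M
    have := Module.free_quotSMulTop_iff_free R M (x := x)
      (IsLocalRing.maximalIdeal_le_jacobson _ hxm) hx
    constructor
    · intro h
      have : Module.Free (R ⧸ Ideal.span {x}) (QuotSMulTop x M) :=
        Module.free_of_flat_of_isLocalRing
      have : Module.Free R M := by tauto
      infer_instance
    · intro h
      have : Module.Free R M := Module.free_of_flat_of_isLocalRing
      infer_instance
  | succ n ih =>
    obtain ⟨ι, _, f, hf, -⟩ := exists_min_cover R M
    have he := exact_ker_subtype f
    have hi := Submodule.injective_subtype (LinearMap.ker f)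
    have hxF : IsSMulRegular (ι →₀ R) x := by
      intro a b hab
      ext i
      exact hxR (by simpa using DFunLike.congr_fun hab i)
    have hxK : IsSMulRegular (LinearMap.ker f) x := by
      intro a b hab
      apply hi
      apply hxF
      simpa using congrArg (Submodule.subtype _) hab
    have h1 : PdLE R (n+1) M ↔ PdLE R n (LinearMap.ker f) := pdLE_succ hi hf he
    rw [h1, ← ih _ hxK]
    exact pdLE_succ (i := qmap x (LinearMap.ker f).subtype) (f := qmap x f)
      (qmap_injective x hi he hx) (QuotSMulTop.map_surjective x hf)
      (QuotSMulTop.map_exact x he hf)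
end quot

end

section
open IsLocalRing

lemma quot_local {R : Type} [CommRing R] [IsLocalRing R] {x : R} (hx : x ∈ maximalIdeal R) :
    IsLocalRing (R ⧸ Ideal.span {x}) := by
  have : Nontrivial (R ⧸ Ideal.span {x}) := by
    rw [Ideal.Quotient.nontrivial_iff]
    intro h
    have := (Ideal.span_singleton_le_iff_mem (maximalIdeal R)).2 hx
    rw [h] at this
    exact (maximalIdeal.isMaximal R).ne_top (top_le_iff.1 this)
  exact IsLocalRing.of_surjective' _ Ideal.Quotient.mk_surjective

lemma quot_max {R : Type} [CommRing R] [IsLocalRing R] {x : R}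
    [IsLocalRing (R ⧸ Ideal.span {x})] (r : R) :
    Ideal.Quotient.mk (Ideal.span {x}) r ∈ maximalIdeal (R ⧸ Ideal.span {x}) ↔
      r ∈ maximalIdeal R := by
  have : IsLocalHom (Ideal.Quotient.mk (Ideal.span {x})) :=
    IsLocalHom.of_surjective _ Ideal.Quotient.mk_surjective
  rw [mem_maximalIdeal, mem_maximalIdeal, mem_nonunits_iff, mem_nonunits_iff, isUnit_map_iff]

/-- Regularity of embedding dimension at most `d` and Krull dimension `d`. -/
def RegN (R : Type) [CommRing R] [IsLocalRing R] (d : ℕ) : Prop :=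
  ringKrullDim R = d ∧ ∃ s : Finset R, s.card ≤ d ∧ Ideal.span (s : Set R) = maximalIdeal R

lemma exists_dim (R : Type) [CommRing R] [IsLocalRing R] [IsNoetherianRing R] :
    ∃ d : ℕ, ringKrullDim R = d := by
  rw [← IsLocalRing.maximalIdeal_height_eq_ringKrullDim]
  obtain ⟨n, hn⟩ := ENat.ne_top_iff_exists.1
    (Ideal.height_ne_top (maximalIdeal.isMaximal R).ne_top :
      (maximalIdeal R).height ≠ ⊤)
  exact ⟨n, by rw [← hn]; rfl⟩

lemma dim_le_card (R : Type) [CommRing R] [IsLocalRing R] [IsNoetherianRing R] (s : Finset R)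
    (hs : Ideal.span (s : Set R) = maximalIdeal R) : ringKrullDim R ≤ s.card := by
  refine (ringKrullDim_le_spanFinrank_maximalIdeal R).trans ?_
  rw [← hs]
  have := Submodule.spanFinrank_span_le_ncard_of_finite (R := R) s.finite_toSet
  rw [Set.ncard_coe_finset] at this
  exact_mod_cast this

lemma regN_iff (R : Type) [CommRing R] [IsLocalRing R] [IsNoetherianRing R] :
    (∃ s : Finset R, Ideal.span (s : Set R) = IsLocalRing.maximalIdeal R ∧
        (s.card : WithBot ℕ∞) = ringKrullDim R) ↔ ∃ d, RegN R d := by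
  constructor
  · rintro ⟨s, hs, h⟩
    exact ⟨s.card, h.symm, s, le_rfl, hs⟩
  · rintro ⟨d, h, s, hsd, hs⟩
    refine ⟨s, hs, le_antisymm ?_ (dim_le_card R s hs)⟩
    rw [h]; exact_mod_cast hsd

lemma avoid (R : Type) [CommRing R] [IsLocalRing R] [IsNoetherianRing R]
    (hm : maximalIdeal R ≠ ⊥) (S : Set (Ideal R)) (hS : S.Finite) (hp : ∀ p ∈ S, p.IsPrime)
    (hmS : maximalIdeal R ∉ S) :
    ∃ x ∈ maximalIdeal R, x ∉ (maximalIdeal R) ^ 2 ∧ ∀ p ∈ S, x ∉ p := by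
  by_contra! h
  have h1 : (maximalIdeal R : Set R) ⊆ ⋃ i ∈ insert ((maximalIdeal R) ^ 2) S, ((id i : Ideal R) : Set R) := by
    intro x hx
    by_cases h2 : x ∈ (maximalIdeal R) ^ 2
    · simp only [Set.mem_iUnion]
      exact ⟨_, Set.mem_insert _ _, h2⟩
    · obtain ⟨p, hp1, hp2⟩ := h x hx h2
      simp only [Set.mem_iUnion]
      exact ⟨p, Set.mem_insert_of_mem _ hp1, hp2⟩
  rw [Ideal.subset_union_prime_finite (hS.insert _) (f := id) ((maximalIdeal R) ^ 2)
    ((maximalIdeal R) ^ 2)] at h1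
  · obtain ⟨p, hp1, hp2⟩ := h1
    rcases hp1 with rfl | hp1
    · apply hm
      apply Submodule.eq_bot_of_le_smul_of_le_jacobson_bot (maximalIdeal R) (maximalIdeal R)
        (IsNoetherian.noetherian _) _ (maximalIdeal_le_jacobson _)
      rw [smul_eq_mul, ← pow_two]; exact hp2
    · have := (maximalIdeal.isMaximal R).eq_of_le (hp p hp1).ne_top hp2
      exact hmS (this ▸ hp1)
  · rintro i (rfl | hi) h1 _
    · exact absurd rfl h1
    · exact hp i hi

lemma dim_quot {R : Type} [CommRing R] [IsLocalRing R] [IsNoetherianRing R] {x : R}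
    (hx : x ∈ maximalIdeal R) (hr : IsSMulRegular R x) :
    ringKrullDim (R ⧸ Ideal.span {x}) + 1 = ringKrullDim R :=
  ringKrullDim_quotient_span_singleton_succ_eq_ringKrullDim_of_mem_jacobson hr
    (by rwa [IsLocalRing.ringJacobson_eq_maximalIdeal])

lemma regN_lift {R : Type} [CommRing R] [IsLocalRing R] [IsNoetherianRing R] {x : R}
    (hx : x ∈ maximalIdeal R) (hr : IsSMulRegular R x) [IsLocalRing (R ⧸ Ideal.span {x})] {d : ℕ}
    (h : RegN (R ⧸ Ideal.span {x}) d) : RegN R (d + 1) := by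
  classical
  obtain ⟨hd, s, hsd, hs⟩ := h
  refine ⟨by rw [← dim_quot hx hr, hd]; push_cast; rfl, insert x (s.image (Function.surjInv Ideal.Quotient.mk_surjective)), ?_, ?_⟩
  · exact (Finset.card_insert_le _ _).trans
      (Nat.add_le_add_right (Finset.card_image_le.trans hsd) 1)
  · set g := Function.surjInv (Ideal.Quotient.mk_surjective (I := Ideal.span {x})) with hg
    have hgi : ∀ a, Ideal.Quotient.mk (Ideal.span {x}) (g a) = a := Function.surjInv_eq _
    have h1 : Ideal.map (Ideal.Quotient.mk (Ideal.span {x})) (Ideal.span (g '' s)) =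
        maximalIdeal (R ⧸ Ideal.span {x}) := by
      rw [Ideal.map_span, ← hs]
      congr 1
      ext a
      simp [hgi]
    rw [Finset.coe_insert, Finset.coe_image, Ideal.span_insert]
    have h2 : Ideal.comap (Ideal.Quotient.mk (Ideal.span {x}))
      (Ideal.map (Ideal.Quotient.mk (Ideal.span {x})) (Ideal.span (g '' s))) = maximalIdeal R := by
      rw [h1]; ext r; rw [Ideal.mem_comap, quot_max]
    rw [← h2, Ideal.comap_map_of_surjective _ Ideal.Quotient.mk_surjective, sup_comm]
    congr 1
    rw [← RingHom.ker_eq_comap_bot, Ideal.mk_ker]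

lemma regN_of_bot (R : Type) [CommRing R] [IsLocalRing R] (h : maximalIdeal R = ⊥) : RegN R 0 :=
  ⟨ringKrullDim_eq_zero_of_isField (IsLocalRing.isField_iff_maximalIdeal_eq.2 h), ∅, le_rfl,
    by simp [h]⟩

lemma regular_of_avoid {R : Type} [CommRing R] [IsNoetherianRing R] {x : R}
    (h : ∀ p ∈ associatedPrimes R R, x ∉ p) : IsSMulRegular R x := by
  by_contra h2
  have : x ∈ ⋃ p ∈ associatedPrimes R R, (p : Set R) := by
    rw [biUnion_associatedPrimes_eq_compl_regular]; exact h2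
  simp only [Set.mem_iUnion] at this
  obtain ⟨p, hp, h3⟩ := this
  exact h p hp h3

lemma residue_not_projective {R : Type} [CommRing R] [IsLocalRing R]
    (hm : maximalIdeal R ≠ ⊥) : ¬ Module.Projective R (ResidueField R) := by
  intro h
  have : Module.Finite R (ResidueField R) :=
    Module.Finite.of_surjective (Algebra.linearMap R (ResidueField R)) residue_surjective
  have := Module.free_of_flat_of_isLocalRing (R := R) (P := ResidueField R)
  apply hm
  rw [eq_bot_iff]
  intro r hr
  have h1 : ∀ a : ResidueField R, r • a = 0 := fun a => by
    rw [Algebra.smul_def]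
    have : algebraMap R (ResidueField R) r = 0 := (residue_eq_zero_iff r).2 hr
    rw [this, zero_mul]
  let b := Module.Free.chooseBasis R (ResidueField R)
  have : Nonempty (Module.Free.ChooseBasisIndex R (ResidueField R)) := b.index_nonempty
  have i := this.some
  have h2 := congrArg (fun a => b.repr a i) (h1 (b i))
  simpa using h2

lemma reg_of_pd (d : ℕ) : ∀ (R : Type) [CommRing R] [IsLocalRing R] [IsNoetherianRing R],
    ringKrullDim R = d → ∀ (n : ℕ), PdLE R n (ResidueField R) → ∃ e, RegN R e := by
  induction d using Nat.strong_induction_on with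
  | h d ih =>
    intro R _ _ _ hd n hn
    by_cases hm : maximalIdeal R = ⊥
    · exact ⟨0, regN_of_bot R hm⟩
    have hfin : Module.Finite R (ResidueField R) :=
      Module.Finite.of_surjective (Algebra.linearMap R (ResidueField R)) residue_surjective
    by_cases hass : maximalIdeal R ∈ associatedPrimes R R
    · exfalso
      obtain ⟨-, s, hs⟩ := isAssociatedPrime_iff.1 hass
      refine residue_not_projective hm (projective_of_socle R s ?_ ?_ n _ hn)
      · rintro rfl
        apply (maximalIdeal.isMaximal R).ne_top
        rw [hs, Ideal.eq_top_iff_one, Submodule.mem_colon_singleton]; simp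
      · intro r hr
        rw [hs, Submodule.mem_colon_singleton] at hr
        rw [mul_comm]; simpa using hr
    obtain ⟨x, hx, hx2, hxp⟩ := avoid R hm (associatedPrimes R R) (associatedPrimes.finite R R)
      (fun p hp => hp.1) hass
    have hr := regular_of_avoid hxp
    have := quot_local hx
    have hdim := dim_quot hx hr
    obtain ⟨e, he⟩ := exists_dim (R ⧸ Ideal.span {x})
    have hed : e + 1 = d := by
      rw [he, hd] at hdim; exact_mod_cast hdim
    have hpm : PdLE R n (maximalIdeal R) := by
      have h1 : PdLE R (n+1) (ResidueField R) ↔ PdLE R n (maximalIdeal R) :=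
        pdLE_succ (i := (maximalIdeal R).subtype) (f := Algebra.linearMap R (ResidueField R))
          (Submodule.subtype_injective _) residue_surjective (by
            intro r
            change residue R r = 0 ↔ _
            rw [residue_eq_zero_iff]
            simp)
      exact h1.1 (hn.mono (Nat.le_succ n))
    have hrm : IsSMulRegular (maximalIdeal R) x := by
      intro a b hab
      exact Subtype.ext (hr (congrArg Subtype.val hab))
    have hW := (pdLE_quot_iff x hx hr n (maximalIdeal R) hrm).2 hpm
    let w : QuotSMulTop x (maximalIdeal R) := Submodule.Quotient.mk ⟨x, hx⟩
    obtain ⟨i, r, hir⟩ := retract_residue (R ⧸ Ideal.span {x}) (QuotSMulTop x (maximalIdeal R)) w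
      (by
        intro a ha
        obtain ⟨a, rfl⟩ := Ideal.Quotient.mk_surjective a
        rw [quot_max] at ha
        change (Submodule.Quotient.mk (a • ⟨x, hx⟩) : QuotSMulTop x (maximalIdeal R)) = 0
        rw [Submodule.Quotient.mk_eq_zero, Submodule.mem_smul_pointwise_iff_exists]
        exact ⟨⟨a, ha⟩, trivial, Subtype.ext (mul_comm _ _)⟩)
      (by
        intro hw
        have hall : ∀ v ∈ (maximalIdeal (R ⧸ Ideal.span {x}) •
            (⊤ : Submodule (R ⧸ Ideal.span {x}) (QuotSMulTop x (maximalIdeal R)))),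
            ∀ y : maximalIdeal R, (Submodule.Quotient.mk y : QuotSMulTop x (maximalIdeal R)) = v →
              (y : R) ∈ (maximalIdeal R) ^ 2 := by
          have key : ∀ y z : maximalIdeal R, (Submodule.Quotient.mk y : QuotSMulTop x (maximalIdeal R)) = Submodule.Quotient.mk z → (z : R) ∈ (maximalIdeal R) ^ 2 → (y : R) ∈ (maximalIdeal R) ^ 2 := by
            intro y z hyz hz
            rw [Submodule.Quotient.eq, Submodule.mem_smul_pointwise_iff_exists] at hyz
            obtain ⟨u, -, hu⟩ := hyz
            have hu' : x * (u : R) = y - z := congrArg Subtype.val hu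
            have : (y : R) = x * u + z := by rw [hu']; ring
            rw [this, pow_two]
            rw [pow_two] at hz
            exact Ideal.add_mem _ (Ideal.mul_mem_mul hx u.2) hz
          intro v hv
          induction hv using Submodule.smul_induction_on' with
          | smul a ha v _ =>
            intro y hy
            obtain ⟨a, rfl⟩ := Ideal.Quotient.mk_surjective a
            obtain ⟨v, rfl⟩ := Submodule.Quotient.mk_surjective _ v
            rw [quot_max] at ha
            refine key y (a • v) hy ?_
            rw [pow_two]
            exact Ideal.mul_mem_mul ha v.2
          | add v hv u hu ihv ihu =>
            intro y hy
            obtain ⟨v, rfl⟩ := Submodule.Quotient.mk_surjective _ v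
            obtain ⟨u, rfl⟩ := Submodule.Quotient.mk_surjective _ u
            exact key y (v + u) hy (Ideal.add_mem _ (ihv v rfl) (ihu u rfl))
        exact hx2 (hall w hw ⟨x, hx⟩ rfl))
    obtain ⟨f, hf⟩ := ih e (by omega) (R ⧸ Ideal.span {x}) he n (pdLE_retract i r hir hW)
    exact ⟨f + 1, regN_lift hx hr hf⟩

/-- Exchange. -/
lemma exchange (R : Type) [CommRing R] [IsLocalRing R] (s : Finset R)
    (hs : Ideal.span (s : Set R) = maximalIdeal R) (x : R) (hx : x ∈ maximalIdeal R)
    (hx2 : x ∉ (maximalIdeal R) ^ 2) :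
    ∃ t : Finset R, t.card + 1 ≤ s.card ∧
      maximalIdeal R ≤ Ideal.span {x} ⊔ Ideal.span (t : Set R) ∧
      Ideal.span (t : Set R) ≤ maximalIdeal R := by
  classical
  have hx' := hx
  rw [← hs] at hx'
  obtain ⟨f, -, hf⟩ := Submodule.mem_span_finset.1 hx'
  have h1 : ∃ a ∈ s, f a ∉ maximalIdeal R := by
    by_contra! h
    apply hx2
    rw [← hf, pow_two]
    exact Ideal.sum_mem _ fun a ha =>
      Ideal.mul_mem_mul (h a ha) (hs ▸ Ideal.subset_span ha)
  obtain ⟨a, ha, hfa⟩ := h1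
  refine ⟨s.erase a, ?_, ?_, ?_⟩
  · rw [Finset.card_erase_add_one ha]
  · rw [← hs, Ideal.span_le]
    intro b hb
    by_cases hba : b = a
    · subst hba
      have hu : IsUnit (f b) := by simpa using hfa
      have h2 : f b * b ∈ Ideal.span {x} ⊔ Ideal.span ((s.erase b : Finset R) : Set R) := by
        have : f b * b = x - ∑ c ∈ s.erase b, f c * c := by
          rw [← hf, ← Finset.add_sum_erase s _ ha]; simp
        rw [this]
        refine Ideal.sub_mem _ (Ideal.mem_sup_left (Ideal.mem_span_singleton_self x)) ?_
        exact Ideal.mem_sup_right (Ideal.sum_mem _ fun c hc =>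
          Ideal.mul_mem_left _ _ (Ideal.subset_span hc))
      exact (Ideal.unit_mul_mem_iff_mem _ hu).1 h2
    · exact Ideal.mem_sup_right (Ideal.subset_span (Finset.mem_coe.2 (Finset.mem_erase.2 ⟨hba, hb⟩)))
  · rw [← hs]
    exact Ideal.span_mono (by simp)

lemma regN_quot {R : Type} [CommRing R] [IsLocalRing R] [IsNoetherianRing R] {x : R}
    (hx : x ∈ maximalIdeal R) (hx2 : x ∉ (maximalIdeal R) ^ 2)
    [IsLocalRing (R ⧸ Ideal.span {x})] {d : ℕ}
    (h : RegN R (d + 1)) : RegN (R ⧸ Ideal.span {x}) d := by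
  classical
  obtain ⟨hd, s, hsd, hs⟩ := h
  obtain ⟨t, ht, h1, h2⟩ := exchange R s hs x hx hx2
  have h3 : Ideal.span ((t.image (Ideal.Quotient.mk (Ideal.span {x})) : Finset _) : Set _) =
      maximalIdeal (R ⧸ Ideal.span {x}) := by
    rw [Finset.coe_image, ← Ideal.map_span]
    apply le_antisymm
    · rw [Ideal.map_le_iff_le_comap]
      intro r hr
      rw [Ideal.mem_comap, quot_max]; exact h2 hr
    · intro r hr
      obtain ⟨r, rfl⟩ := Ideal.Quotient.mk_surjective r
      rw [quot_max] at hr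
      obtain ⟨a, b, hb, rfl⟩ := Ideal.mem_span_singleton_sup.1 (h1 hr)
      have h0 : Ideal.Quotient.mk (Ideal.span {x}) (a * x) = 0 :=
        Ideal.Quotient.eq_zero_iff_mem.2 (Ideal.mul_mem_left _ _ (Ideal.mem_span_singleton_self x))
      rw [map_add, h0, zero_add]
      exact Ideal.mem_map_of_mem _ hb
  have h4 : (t.image (Ideal.Quotient.mk (Ideal.span {x}))).card ≤ d :=
    Finset.card_image_le.trans (by omega)
  refine ⟨?_, _, h4, h3⟩
  obtain ⟨e, he⟩ := exists_dim (R ⧸ Ideal.span {x})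
  have h5 := dim_le_card _ _ h3
  have h6 := ringKrullDim_le_ringKrullDim_quotient_add_card ({x} : Finset R)
    (by rw [IsLocalRing.ringJacobson_eq_maximalIdeal]; simpa using hx)
  rw [Finset.coe_singleton, hd, he, Finset.card_singleton] at h6
  rw [he] at h5 ⊢
  have h7 : e ≤ d := by
    have : e ≤ (t.image (Ideal.Quotient.mk (Ideal.span {x}))).card := by exact_mod_cast h5
    omega
  have h8 : d + 1 ≤ e + 1 := by exact_mod_cast h6
  have : e = d := by omega
  rw [this]

lemma bot_of_regN_zero {R : Type} [CommRing R] [IsLocalRing R] (h : RegN R 0) :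
    maximalIdeal R = ⊥ := by
  obtain ⟨_, s, h1, h2⟩ := h
  rw [← h2, Finset.card_eq_zero.1 (Nat.le_zero.1 h1)]; simp

lemma regN_ne_bot {R : Type} [CommRing R] [IsLocalRing R] {d : ℕ} (h : RegN R (d + 1)) :
    maximalIdeal R ≠ ⊥ := by
  intro h0
  have := (regN_of_bot R h0).1
  rw [h.1] at this
  exact absurd (by exact_mod_cast this : d + 1 = 0) (by omega)

lemma isDomain_of_regN (d : ℕ) : ∀ (R : Type) [CommRing R] [IsLocalRing R] [IsNoetherianRing R],
    RegN R d → IsDomain R := by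
  induction d with
  | zero =>
    intro R _ _ _ h
    exact (IsLocalRing.isField_iff_maximalIdeal_eq.2 (bot_of_regN_zero h)).isDomain
  | succ d ih =>
    intro R _ _ _ h
    obtain ⟨x, hx, hx2, hxp⟩ := avoid R (regN_ne_bot h) (minimalPrimes R)
      (minimalPrimes.finite_of_isNoetherianRing R) (fun p hp => hp.1.1) (by
        intro hmin
        have h1 := Ideal.height_eq_zero_iff.2 hmin
        have h2 := IsLocalRing.maximalIdeal_height_eq_ringKrullDim (R := R)
        rw [h1, h.1] at h2
        exact absurd (by exact_mod_cast h2 : 0 = d + 1) (by omega))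
    have := quot_local hx
    have hdom := ih _ (regN_quot hx hx2 h)
    have hprime : (Ideal.span {x}).IsPrime := (Ideal.Quotient.isDomain_iff_prime _).1 hdom
    obtain ⟨p, hp, hpx⟩ := Ideal.exists_minimalPrimes_le (bot_le : (⊥ : Ideal R) ≤ Ideal.span {x})
    have hxp := hxp p hp
    have hpp : p.IsPrime := hp.1.1
    have hbot : p = ⊥ := by
      apply Submodule.eq_bot_of_le_smul_of_le_jacobson_bot (maximalIdeal R) p
        (IsNoetherian.noetherian _) _ (maximalIdeal_le_jacobson _)
      intro y hy
      obtain ⟨z, rfl⟩ := Ideal.mem_span_singleton'.1 (hpx hy)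
      have hz : z ∈ p := (hpp.mem_or_mem hy).resolve_right hxp
      rw [mul_comm, smul_eq_mul]
      exact Ideal.mul_mem_mul hx hz
    rw [hbot] at hpp
    exact (IsDomain.of_bot_isPrime R)

lemma exists_regular_param {R : Type} [CommRing R] [IsLocalRing R] [IsNoetherianRing R] {d : ℕ}
    (h : RegN R (d + 1)) : ∃ x ∈ maximalIdeal R, x ∉ (maximalIdeal R) ^ 2 ∧ IsSMulRegular R x := by
  have := isDomain_of_regN _ R h
  obtain ⟨x, hx, hx2, -⟩ := avoid R (regN_ne_bot h) ∅ Set.finite_empty (by simp) (by simp)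
  refine ⟨x, hx, hx2, ?_⟩
  have : x ≠ 0 := by rintro rfl; exact hx2 (Ideal.zero_mem _)
  exact IsSMulRegular.of_ne_zero this

lemma pd_of_regN (d : ℕ) : ∀ (R : Type) [CommRing R] [IsLocalRing R] [IsNoetherianRing R],
    RegN R d → ∀ (M : Type) [AddCommGroup M] [Module R M] [Module.Finite R M], PdLE R d M := by
  induction d with
  | zero =>
    intro R _ _ _ h M _ _ _
    rw [pdLE_zero]
    let := (IsLocalRing.isField_iff_maximalIdeal_eq.2 (bot_of_regN_zero h)).toField
    exact Module.Projective.of_free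
  | succ d ih =>
    intro R _ _ _ h M _ _ _
    obtain ⟨x, hx, hx2, hr⟩ := exists_regular_param h
    have := quot_local hx
    obtain ⟨n, f, hf⟩ := Module.Finite.exists_fin' R M
    have h1 : PdLE R (d+1) M ↔ PdLE R d (LinearMap.ker f) :=
      pdLE_succ (Submodule.subtype_injective _) hf (exact_ker_subtype f)
    rw [h1, ← pdLE_quot_iff x hx hr d (LinearMap.ker f)]
    · have : Module.Finite (R ⧸ Ideal.span {x}) (QuotSMulTop x (LinearMap.ker f)) :=
        Module.Finite.of_restrictScalars_finite R _ _
      exact ih _ (regN_quot hx hx2 h) _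
    · intro a b hab
      apply Subtype.ext
      funext i
      exact hr (congrFun (congrArg Subtype.val hab) i)

lemma pd_all_of_regN (d : ℕ) (R : Type) [CommRing R] [IsLocalRing R] [IsNoetherianRing R]
    (h : RegN R d) (M : Type) [AddCommGroup M] [Module R M] : PdLE R d M :=
  pdLE_all R d (fun _ => pd_of_regN d R h _) M

end

section
section
variable {R : Type} [CommRing R] {C : Type} [AddCommGroup C] [Module R C]
  (P : ℕ → ModuleCat.{0} R) (d : ∀ n, ↥(P (n + 1)) →ₗ[R] ↥(P n)) (ε : ↥(P 0) →ₗ[R] C)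
  (h0 : Function.Exact (d 0) ε) (hd : ∀ n, Function.Exact (d (n + 1)) (d n))

def resCx (hd : ∀ n, Function.Exact (d (n + 1)) (d n)) : ChainComplex (ModuleCat.{0} R) ℕ :=
  ChainComplex.of P (fun n => ModuleCat.ofHom (d n)) (fun n => by
    rw [← ModuleCat.ofHom_comp, (hd n).linearMap_comp_eq_zero]; rfl)

lemma resCx_X (n : ℕ) : (resCx P d hd).X n = P n := rfl

lemma resCx_d (n : ℕ) : (resCx P d hd).d (n+1) n = ModuleCat.ofHom (d n) :=
  ChainComplex.of_d P (fun n => ModuleCat.ofHom (d n)) n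

def resPi : resCx P d hd ⟶ (ChainComplex.single₀ (ModuleCat.{0} R)).obj (ModuleCat.of R C) :=
  (ChainComplex.toSingle₀Equiv _ _).symm ⟨(ModuleCat.ofHom ε : P 0 ⟶ _), by
    rw [resCx_d]
    exact ModuleCat.hom_ext h0.linearMap_comp_eq_zero⟩

lemma resPi_f : (resPi P d ε h0 hd).f 0 = (ModuleCat.ofHom ε : P 0 ⟶ _) :=
  ChainComplex.toSingle₀Equiv_symm_apply_f_zero _ _

def resProj (hP : ∀ n, Module.Projective R (P n)) (hε : Function.Surjective ε) :
    ProjectiveResolution (ModuleCat.of R C) where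
  complex := resCx P d hd
  projective n := (IsProjective.iff_projective (P n)).1 (hP n)
  π := resPi P d ε h0 hd
  quasiIso := ⟨fun n => by
    rcases n with _ | n
    · rw [ChainComplex.quasiIsoAt₀_iff, ShortComplex.quasiIso_iff_of_zeros']
      · constructor
        · rw [ShortComplex.ShortExact.moduleCat_exact_iff_function_exact]
          change Function.Exact ((resCx P d hd).d 1 0) ((resPi P d ε h0 hd).f 0)
          rw [resPi_f, resCx_d]
          exact h0
        · change Epi ((resPi P d ε h0 hd).f 0)
          rw [resPi_f]
          exact (ModuleCat.epi_iff_surjective _).2 hε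
      all_goals rfl
    · rw [quasiIsoAt_iff_exactAt']
      · rw [HomologicalComplex.exactAt_iff' _ (n + 1 + 1) (n + 1) n (by simp) (by simp)]
        rw [ShortComplex.ShortExact.moduleCat_exact_iff_function_exact]
        change Function.Exact ((resCx P d hd).d (n+2) (n+1)) ((resCx P d hd).d (n+1) n)
        rw [resCx_d, resCx_d]
        exact hd n
      · exact ChainComplex.exactAt_succ_single_obj _ _⟩

lemma factor_of_ext (h0 : Function.Exact (d 0) ε)
    (hd : ∀ n, Function.Exact (d (n + 1)) (d n)) (hP : ∀ n, Module.Projective R (P n)) (hε : Function.Surjective ε)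
    (N : Type) [AddCommGroup N] [Module R N] (n : ℕ)
    (h : Subsingleton (((Ext R (ModuleCat R) (n+1)).obj (Opposite.op (ModuleCat.of R C))).obj
      (ModuleCat.of R N)))
    (f : P (n+1) →ₗ[R] N) (hf : f ∘ₗ d (n+1) = 0) : ∃ g : P n →ₗ[R] N, g ∘ₗ d n = f := by
  have h1 := (ModuleCat.isZero_of_subsingleton _).of_iso
    ((resProj P d ε h0 hd hP hε).isoExt (R := R) (n+1) (ModuleCat.of R N)).symm
  rw [← HomologicalComplex.exactAt_iff_isZero_homology,
    HomologicalComplex.exactAt_iff' _ n (n+1) (n+1+1) (by simp) (by simp),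
    ShortComplex.ShortExact.moduleCat_exact_iff_function_exact] at h1
  have h2 := (h1 (ModuleCat.ofHom f : P (n+1) ⟶ _)).1 (by
    change (resCx P d hd).d (n+2) (n+1) ≫ (ModuleCat.ofHom f : P (n+1) ⟶ _) = 0
    rw [resCx_d]
    exact ModuleCat.hom_ext hf)
  obtain ⟨g, hg⟩ := h2
  change P n ⟶ ModuleCat.of R N at g
  change (resCx P d hd).d (n+1) n ≫ g = _ at hg
  rw [resCx_d] at hg
  exact ⟨g.hom, congrArg ModuleCat.Hom.hom hg⟩
end

/-- Elementary vanishing of positive Ext computed with a fixed resolution. -/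
def EV {R : Type} [CommRing R] {P : ℕ → ModuleCat.{0} R}
    (d : ∀ n, ↥(P (n + 1)) →ₗ[R] ↥(P n)) (N : Type) [AddCommGroup N] [Module R N] : Prop :=
  ∀ (n : ℕ) (f : P (n+1) →ₗ[R] N), f ∘ₗ d (n+1) = 0 → ∃ g : P n →ₗ[R] N, g ∘ₗ d n = f

section
variable {R : Type} [CommRing R]

lemma descend {P Y N : Type} [AddCommGroup P] [AddCommGroup Y] [AddCommGroup N] [Module R P]
    [Module R Y] [Module R N] (p : P →ₗ[R] Y) (hp : Function.Surjective p) (g : P →ₗ[R] N)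
    (h : ∀ x, p x = 0 → g x = 0) : ∃ s : Y →ₗ[R] N, s ∘ₗ p = g := by
  refine ⟨(LinearMap.ker p).liftQ g (fun x hx => h x hx) ∘ₗ
    (p.quotKerEquivOfSurjective hp).symm.toLinearMap, ?_⟩
  ext x
  have : (p.quotKerEquivOfSurjective hp).symm (p x) = Submodule.Quotient.mk x := by
    rw [LinearEquiv.symm_apply_eq]; rfl
  simp only [LinearMap.comp_apply, LinearEquiv.coe_coe, this]
  rfl

lemma fin_supp {M C I : Type} [AddCommGroup M] [Module R M] [AddCommGroup C] [Module R C]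
    [Module.Finite R M] (f : M →ₗ[R] (I →₀ C)) :
    ∃ S : Finset I, ∀ m, ∀ i, i ∉ S → f m i = 0 := by
  classical
  obtain ⟨G, hG⟩ := Module.Finite.fg_top (R := R) (M := M)
  refine ⟨G.biUnion fun g => (f g).support, fun m i hi => ?_⟩
  have hm : m ∈ Submodule.span R (G : Set M) := hG ▸ trivial
  induction hm using Submodule.span_induction with
  | mem x hx =>
    by_contra h
    exact hi (Finset.mem_biUnion.2 ⟨x, hx, Finsupp.mem_support_iff.2 h⟩)
  | zero => simp
  | add x y _ _ hx hy => simp [hx, hy]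
  | smul a x _ hx => simp [hx]

variable {P : ℕ → ModuleCat.{0} R} {d : ∀ n, ↥(P (n + 1)) →ₗ[R] ↥(P n)}

lemma EV.retract {N N' : Type} [AddCommGroup N] [Module R N] [AddCommGroup N'] [Module R N']
    (h : EV d N) (i : N' →ₗ[R] N) (r : N →ₗ[R] N') (hir : r ∘ₗ i = LinearMap.id) : EV d N' := by
  intro n f hf
  obtain ⟨g, hg⟩ := h n (i ∘ₗ f) (by rw [LinearMap.comp_assoc, hf, LinearMap.comp_zero])
  refine ⟨r ∘ₗ g, ?_⟩
  rw [LinearMap.comp_assoc, hg, ← LinearMap.comp_assoc, hir, LinearMap.id_comp]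

lemma EV.finsupp (hfin : ∀ n, Module.Finite R (P n)) {C : Type} [AddCommGroup C] [Module R C]
    (h : EV d C) (I : Type) : EV d (I →₀ C) := by
  classical
  intro n f hf
  have := hfin (n+1)
  obtain ⟨S, hS⟩ := fin_supp f
  choose g hg using fun i : I => h n (Finsupp.lapply i ∘ₗ f)
    (by rw [LinearMap.comp_assoc, hf, LinearMap.comp_zero])
  refine ⟨∑ i ∈ S, Finsupp.lsingle i ∘ₗ g i, ?_⟩
  ext x j
  have hgj : g j (d n x) = f x j := LinearMap.congr_fun (hg j) x
  by_cases hj : j ∈ S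
  · simp [Finsupp.finsetSum_apply, Finsupp.single_apply, hj, hgj]
  · simp [Finsupp.finsetSum_apply, Finsupp.single_apply, hj, hS x j hj]

lemma EV.coker (hproj : ∀ n, Module.Projective R (P n)) {A B D : Type} [AddCommGroup A]
    [AddCommGroup B] [AddCommGroup D] [Module R A] [Module R B] [Module R D]
    (hd : ∀ n, Function.Exact (d (n + 1)) (d n))
    (hA : EV d A) (hB : EV d B) (i : A →ₗ[R] B) (f : B →ₗ[R] D) (hi : Function.Injective i)
    (hf : Function.Surjective f) (he : Function.Exact i f) : EV d D := by
  intro n u hu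
  have := hproj (n+1)
  obtain ⟨v, hv⟩ := Module.projective_lifting_property f u hf
  have hw : ∃ w : P (n+1+1) →ₗ[R] A, i ∘ₗ w = v ∘ₗ d (n+1) := by
    have h1 : ∀ x, v (d (n+1) x) ∈ LinearMap.range i := fun x => by
      apply (he _).1
      have := LinearMap.congr_fun hv (d (n+1) x)
      rw [LinearMap.comp_apply] at this
      rw [this]
      exact LinearMap.congr_fun hu x
    refine ⟨(LinearEquiv.ofInjective i hi).symm.toLinearMap ∘ₗ
      (v ∘ₗ d (n+1)).codRestrict (LinearMap.range i) h1, ?_⟩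
    ext x
    exact congrArg Subtype.val ((LinearEquiv.ofInjective i hi).apply_symm_apply ⟨_, h1 x⟩)
  obtain ⟨w, hw⟩ := hw
  obtain ⟨w', hw'⟩ := hA (n+1) w (by
    ext x
    apply hi
    have h1 := LinearMap.congr_fun hw (d (n+2) x)
    rw [LinearMap.comp_apply, LinearMap.comp_apply, (hd (n+1)).apply_apply_eq_zero] at h1
    simpa using h1)
  obtain ⟨g, hg⟩ := hB n (v - i ∘ₗ w') (by
    rw [LinearMap.sub_comp, LinearMap.comp_assoc, hw', hw, sub_self])
  refine ⟨f ∘ₗ g, ?_⟩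
  rw [LinearMap.comp_assoc, hg, LinearMap.comp_sub, hv, ← LinearMap.comp_assoc,
    he.linearMap_comp_eq_zero, LinearMap.zero_comp, sub_zero]

lemma EV.hom_surj {C : Type} [AddCommGroup C] [Module R C] {ε : P 0 →ₗ[R] C}
    (hproj : ∀ n, Module.Projective R (P n)) {A B D : Type} [AddCommGroup A]
    [AddCommGroup B] [AddCommGroup D] [Module R A] [Module R B] [Module R D]
    (hε : Function.Surjective ε) (h0 : Function.Exact (d 0) ε)
    (hd : ∀ n, Function.Exact (d (n + 1)) (d n))
    (hA : EV d A) (i : A →ₗ[R] B) (f : B →ₗ[R] D) (hi : Function.Injective i)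
    (hf : Function.Surjective f) (he : Function.Exact i f) (φ : C →ₗ[R] D) :
    ∃ ψ : C →ₗ[R] B, f ∘ₗ ψ = φ := by
  have := hproj 0
  obtain ⟨v, hv⟩ := Module.projective_lifting_property f (φ ∘ₗ ε) hf
  have hw : ∃ w : P (0+1) →ₗ[R] A, i ∘ₗ w = v ∘ₗ d 0 := by
    have h1 : ∀ x, v (d 0 x) ∈ LinearMap.range i := fun x => by
      apply (he _).1
      have := LinearMap.congr_fun hv (d 0 x)
      rw [LinearMap.comp_apply] at this
      rw [this, LinearMap.comp_apply, h0.apply_apply_eq_zero, map_zero]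
    refine ⟨(LinearEquiv.ofInjective i hi).symm.toLinearMap ∘ₗ
      (v ∘ₗ d 0).codRestrict (LinearMap.range i) h1, ?_⟩
    ext x
    exact congrArg Subtype.val ((LinearEquiv.ofInjective i hi).apply_symm_apply ⟨_, h1 x⟩)
  obtain ⟨w, hw⟩ := hw
  obtain ⟨w', hw'⟩ := hA 0 w (by
    ext x
    apply hi
    have h1 := LinearMap.congr_fun hw (d 1 x)
    rw [LinearMap.comp_apply, LinearMap.comp_apply, (hd 0).apply_apply_eq_zero] at h1
    simpa using h1)
  obtain ⟨ψ, hψ⟩ := descend ε hε (v - i ∘ₗ w') (by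
    intro x hx
    obtain ⟨y, rfl⟩ := (h0 x).1 hx
    have h1 := LinearMap.congr_fun hw y
    have h2 := LinearMap.congr_fun hw' y
    simp only [LinearMap.comp_apply] at h1 h2
    simp [h2, h1])
  refine ⟨ψ, ?_⟩
  ext c
  obtain ⟨x, rfl⟩ := hε c
  have h1 := LinearMap.congr_fun hψ x
  have h2 := LinearMap.congr_fun hv x
  simp only [LinearMap.comp_apply, LinearMap.sub_apply] at h1 h2 ⊢
  rw [h1, map_sub, h2, he.apply_apply_eq_zero, sub_zero]

/-- `Hom(C, C^(I))` is free. -/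
lemma homFinsupp_projective {C : Type} [AddCommGroup C] [Module R C] [Module.Finite R C]
    (hb : Function.Bijective (fun r : R => (r • LinearMap.id : C →ₗ[R] C))) (I : Type) :
    Module.Projective R (C →ₗ[R] (I →₀ C)) := by
  classical
  let Φ : (I →₀ R) →ₗ[R] (C →ₗ[R] (I →₀ C)) :=
    Finsupp.linearCombination R (fun i => (Finsupp.lsingle i : C →ₗ[R] (I →₀ C)))
  have hΦ : ∀ a c i, Φ a c i = a i • c := by
    intro a c i
    simp only [Φ, Finsupp.linearCombination_apply, Finsupp.sum]
    simp [Finsupp.finsetSum_apply, LinearMap.sum_apply, Finsupp.single_apply]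
    intro h
    simp [h]
  have hbij : Function.Bijective Φ := by
    constructor
    · rw [injective_iff_map_eq_zero]
      intro a ha
      ext i
      apply hb.1
      ext c
      have := hΦ a c i
      rw [ha] at this
      simpa using this.symm
    · intro h
      obtain ⟨S, hS⟩ := fin_supp h
      choose r hr using fun i : I => hb.2 (Finsupp.lapply i ∘ₗ h)
      refine ⟨∑ i ∈ S, Finsupp.single i (r i), ?_⟩
      ext c i
      rw [hΦ]
      have h1 : r i • c = h c i := LinearMap.congr_fun (hr i) c
      by_cases hi : i ∈ S
      · simp [Finsupp.finsetSum_apply, Finsupp.single_apply, hi, h1]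
      · simp [Finsupp.finsetSum_apply, Finsupp.single_apply, hi, hS c i hi]
  exact Module.Projective.of_equiv (LinearEquiv.ofBijective Φ hbij)

lemma tensor_retract (C Q : Type) [AddCommGroup C] [Module R C] [AddCommGroup Q] [Module R Q]
    [Module.Projective R Q] : ∃ (i : C ⊗[R] Q →ₗ[R] (Q →₀ C)) (r : (Q →₀ C) →ₗ[R] C ⊗[R] Q),
      r ∘ₗ i = LinearMap.id := by
  classical
  obtain ⟨s, hs⟩ := Module.projective_def'.1 (inferInstance : Module.Projective R Q)
  let e : C ⊗[R] (Q →₀ R) ≃ₗ[R] (Q →₀ C) := TensorProduct.finsuppScalarRight R R C Q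
  refine ⟨e.toLinearMap ∘ₗ s.lTensor C,
    (Finsupp.linearCombination R id).lTensor C ∘ₗ e.symm.toLinearMap, ?_⟩
  ext x y
  have h1 := LinearMap.congr_fun hs y
  simp only [LinearMap.comp_apply, LinearMap.id_apply] at h1
  simp [h1]
end

end

section
open IsLocalRing

lemma hom_pd {R : Type} [CommRing R] {C : Type} [AddCommGroup C] [Module R C] [Module.Finite R C]
    {P : ℕ → ModuleCat.{0} R} {d : ∀ n, ↥(P (n + 1)) →ₗ[R] ↥(P n)} {ε : P 0 →ₗ[R] C}
    (hfin : ∀ n, Module.Finite R (P n))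
    (hproj : ∀ n, Module.Projective R (P n))
    (hε : Function.Surjective ε) (h0 : Function.Exact (d 0) ε)
    (hd : ∀ n, Function.Exact (d (n + 1)) (d n))
    (hb : Function.Bijective (fun r : R => (r • LinearMap.id : C →ₗ[R] C)))
    (hC : EV d C) (n : ℕ) : ∀ (M : Type) [AddCommGroup M] [Module R M],
    HasBoundedExactCRes R C M n → EV d M ∧ PdLE R n (C →ₗ[R] M) := by
  have base : ∀ (Q : Type) [AddCommGroup Q] [Module R Q], Module.Projective R Q →
      EV d (C ⊗[R] Q) ∧ Module.Projective R (C →ₗ[R] C ⊗[R] Q) := by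
    intro Q _ _ hQ
    obtain ⟨i, r, hir⟩ := tensor_retract (R := R) C Q
    refine ⟨(hC.finsupp hfin Q).retract i r hir, ?_⟩
    have := homFinsupp_projective hb Q
    refine Module.Projective.of_split (i.compRight R : (C →ₗ[R] C ⊗[R] Q) →ₗ[R] _)
      (r.compRight R : _ →ₗ[R] (C →ₗ[R] C ⊗[R] Q)) ?_
    ext1 f
    change r ∘ₗ (i ∘ₗ f) = f
    rw [← LinearMap.comp_assoc, hir, LinearMap.id_comp]
  induction n with
  | zero =>
    rintro M _ _ ⟨Q, δ, η, hQ, ⟨hη, hδη, hδ⟩, hs⟩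
    have := hs 1 (by omega)
    have hinj : Function.Injective η := by
      rw [injective_iff_map_eq_zero]
      intro x hx
      obtain ⟨y, rfl⟩ := (hδη x).1 hx
      rw [Subsingleton.elim y 0, map_zero]
    let e := LinearEquiv.ofBijective η ⟨hinj, hη⟩
    obtain ⟨h1, h2⟩ := base (Q 0) (hQ 0)
    refine ⟨h1.retract e.symm.toLinearMap e.toLinearMap (by ext; simp), ?_⟩
    rw [pdLE_zero]
    exact Module.Projective.of_equiv (LinearEquiv.congrRight e : (C →ₗ[R] _) ≃ₗ[R] (C →ₗ[R] M))
  | succ n ih =>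
    rintro M _ _ ⟨Q, δ, η, hQ, ⟨hη, hδη, hδ⟩, hs⟩
    obtain ⟨h1, h2⟩ := base (Q 0) (hQ 0)
    have hK : HasBoundedExactCRes R C (LinearMap.ker η) n := by
      refine ⟨fun i => Q (i+1), fun i => δ (i+1),
        (δ 0).codRestrict (LinearMap.ker η) (fun x => hδη.apply_apply_eq_zero x),
        fun i => hQ (i+1), ⟨?_, ?_, fun i => hδ (i+1)⟩, fun i hi => hs (i+1) (by omega)⟩
      · rintro ⟨x, hx⟩
        obtain ⟨y, rfl⟩ := (hδη x).1 hx
        exact ⟨y, rfl⟩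
      · intro x
        rw [← hδ 0 x, ← Subtype.val_inj]
        rfl
    obtain ⟨hK1, hK2⟩ := ih _ hK
    have hi := Submodule.subtype_injective (LinearMap.ker η)
    have he := exact_ker_subtype η
    refine ⟨EV.coker hproj hd hK1 h1 (LinearMap.ker η).subtype η hi hη he, ?_⟩
    have hF : PdLE R (n+1) (C →ₗ[R] C ⊗[R] Q 0) := (pdLE_zero.2 h2).mono (Nat.zero_le _)
    refine pdLE_three (K := C →ₗ[R] LinearMap.ker η) (F := C →ₗ[R] C ⊗[R] Q 0)
      (i := ((LinearMap.ker η).subtype.compRight R))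
      (f := (η.compRight R)) ?_ ?_ ?_ hK2 hF
    · intro a b hab
      ext1 c
      exact hi (LinearMap.congr_fun hab c)
    · intro φ
      exact EV.hom_surj hproj hε h0 hd hK1 (LinearMap.ker η).subtype η hi hη he φ
    · intro φ
      constructor
      · intro hφ
        exact ⟨φ.codRestrict _ (fun c => LinearMap.congr_fun hφ c), rfl⟩
      · rintro ⟨ψ, rfl⟩
        ext1 c
        exact he.apply_apply_eq_zero (ψ c)

lemma exists_to_residue (R : Type) [CommRing R] [IsLocalRing R] (C : Type) [AddCommGroup C]
    [Module R C] [Module.Finite R C] [Nontrivial C] :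
    ∃ f : C →ₗ[R] ResidueField R, Function.Surjective f := by
  obtain ⟨ι, _, f, hf, hker⟩ := exists_min_cover R C
  have : Nonempty ι := by
    by_contra h
    rw [not_nonempty_iff] at h
    have := hf.subsingleton
    exact not_subsingleton C this
  obtain ⟨i⟩ := this
  obtain ⟨s, hs⟩ := descend f hf (Algebra.linearMap R (ResidueField R) ∘ₗ Finsupp.lapply i)
    (fun x hx => (residue_eq_zero_iff _).2 (hker x hx i))
  refine ⟨s, fun y => ?_⟩
  obtain ⟨r, rfl⟩ := residue_surjective y
  refine ⟨f (Finsupp.single i r), ?_⟩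
  have := LinearMap.congr_fun hs (Finsupp.single i r)
  simp only [LinearMap.comp_apply] at this
  rw [this]; simp

lemma pd_residue_of_hom (R : Type) [CommRing R] [IsLocalRing R] (C : Type) [AddCommGroup C]
    [Module R C] [Module.Finite R C] [Nontrivial C] (n : ℕ)
    (h : PdLE R n (C →ₗ[R] ResidueField R)) : PdLE R n (ResidueField R) := by
  obtain ⟨w, hw⟩ := exists_to_residue R C
  have h0 : ∀ a ∈ maximalIdeal R, ∀ v : C →ₗ[R] ResidueField R, a • v = 0 := by
    intro a ha v
    ext1 c
    rw [LinearMap.smul_apply, Algebra.smul_def]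
    have : algebraMap R (ResidueField R) a = 0 := (residue_eq_zero_iff a).2 ha
    rw [this, zero_mul]; rfl
  obtain ⟨i, r, hir⟩ := retract_residue R (C →ₗ[R] ResidueField R) w (fun a ha => h0 a ha w) (by
    have hbot : maximalIdeal R • (⊤ : Submodule R (C →ₗ[R] ResidueField R)) = ⊥ := by
      rw [eq_bot_iff, Submodule.smul_le]
      intro a ha v _
      rw [h0 a ha v]; exact Submodule.zero_mem _
    rw [hbot, Submodule.mem_bot]
    rintro rfl
    obtain ⟨c, hc⟩ := hw 1
    exact zero_ne_one hc)
  exact pdLE_retract i r hir h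

/-- Descending step. -/
lemma desc_step {R : Type} [CommRing R] [IsLocalRing R] [IsNoetherianRing R] {C Z P Y : Type}
    [AddCommGroup C] [Module R C] [Module.Finite R C] [Nontrivial C]
    [AddCommGroup Z] [Module R Z] [AddCommGroup P] [Module R P] [AddCommGroup Y] [Module R Y]
    [Module.Finite R P] [Module.Projective R P] [Module.Projective R Z]
    (i : Z →ₗ[R] P) (p : P →ₗ[R] Y) (hi : Function.Injective i) (hp : Function.Surjective p)
    (he : Function.Exact i p) (hext : ∀ f : Z →ₗ[R] C, ∃ g : P →ₗ[R] C, g ∘ₗ i = f) :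
    Module.Projective R Y := by
  classical
  have : Module.Finite R Z := Module.Finite.of_injective i hi
  have := Module.free_of_flat_of_isLocalRing (R := R) (P := Z)
  let b := Module.Free.chooseBasis R Z
  obtain ⟨q, hq⟩ := exists_to_residue R C
  obtain ⟨c, hc⟩ := hq 1
  have h1 : ∀ j, ∃ ψ : P →ₗ[R] R, ∀ z, residue R (ψ (i z)) = residue R (b.repr z j) := by
    intro j
    obtain ⟨g, hg⟩ := hext (LinearMap.toSpanSingleton R C c ∘ₗ b.coord j)
    obtain ⟨ψ, hψ⟩ := Module.projective_lifting_property (Algebra.linearMap R (ResidueField R))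
      (q ∘ₗ g) residue_surjective
    refine ⟨ψ, fun z => ?_⟩
    have h2 := LinearMap.congr_fun hψ (i z)
    have h3 := LinearMap.congr_fun hg z
    simp only [LinearMap.comp_apply] at h2 h3
    change residue R (ψ (i z)) = _ at h2
    rw [h2, h3, LinearMap.toSpanSingleton_apply, map_smul, hc, Algebra.smul_def, mul_one]
    rfl
  choose ψ hψ using h1
  let ρ : P →ₗ[R] Z := ∑ j, (LinearMap.toSpanSingleton R Z (b j)) ∘ₗ ψ j
  have hρ : ∀ x, ρ x = ∑ j, ψ j x • b j := fun x => by
    simp [ρ, LinearMap.sum_apply]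
  have hsurj : Function.Surjective (ρ ∘ₗ i) := by
    rw [← LinearMap.range_eq_top, ← top_le_iff]
    refine Submodule.le_of_le_smul_of_le_jacobson_bot (I := maximalIdeal R)
      (Module.Finite.fg_top) (maximalIdeal_le_jacobson _) ?_
    intro z _
    have hz : z = (ρ ∘ₗ i) z + (z - (ρ ∘ₗ i) z) := by abel
    rw [hz]
    refine Submodule.add_mem_sup ⟨z, rfl⟩ ?_
    have : z - (ρ ∘ₗ i) z = ∑ j, (b.repr z j - ψ j (i z)) • b j := by
      simp only [sub_smul, Finset.sum_sub_distrib]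
      rw [b.sum_repr, LinearMap.comp_apply, hρ]
    rw [this]
    refine Submodule.sum_mem _ fun j _ => Submodule.smul_mem_smul ?_ trivial
    rw [← residue_eq_zero_iff, map_sub, hψ, sub_self]
  have hinj : Function.Injective (ρ ∘ₗ i) :=
    IsNoetherian.injective_of_surjective_endomorphism _ hsurj
  let e := LinearEquiv.ofBijective (ρ ∘ₗ i) ⟨hinj, hsurj⟩
  have hri : ∀ z, e.symm (ρ (i z)) = z := fun z => by
    rw [LinearEquiv.symm_apply_eq]; rfl
  obtain ⟨s, hs⟩ := descend p hp (LinearMap.id - i ∘ₗ e.symm.toLinearMap ∘ₗ ρ) (by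
    intro x hx
    obtain ⟨z, rfl⟩ := (he x).1 hx
    simp [hri])
  refine Module.Projective.of_split s p ?_
  ext y
  obtain ⟨x, rfl⟩ := hp y
  have := LinearMap.congr_fun hs x
  simp only [LinearMap.comp_apply] at this ⊢
  rw [this]
  simp [he.apply_apply_eq_zero]

lemma exists_proj_syzygy {R : Type} [CommRing R] {P : ℕ → ModuleCat.{0} R}
    {d : ∀ n, ↥(P (n + 1)) →ₗ[R] ↥(P n)} (hproj : ∀ n, Module.Projective R (P n))
    (hd : ∀ n, Function.Exact (d (n + 1)) (d n)) (k : ℕ) :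
    ∀ n, PdLE R k (LinearMap.range (d n)) → ∃ N, Module.Projective R (LinearMap.range (d N)) := by
  induction k with
  | zero => exact fun n h => ⟨n, pdLE_zero.1 h⟩
  | succ k ih =>
    intro n h
    apply ih (n+1)
    have := hproj (n+1)
    have h1 : PdLE R (k+1) (LinearMap.range (d n)) ↔ PdLE R k (LinearMap.range (d (n+1))) :=
      pdLE_succ (F := P (n+1)) (i := (LinearMap.range (d (n+1))).subtype) (f := (d n).rangeRestrict)
        (Submodule.subtype_injective _) (LinearMap.surjective_rangeRestrict _) (by
          intro x
          rw [← Subtype.val_inj]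
          change d n x = 0 ↔ _
          rw [hd n x]
          simp)
    exact h1.1 h

lemma C_equiv_R {R : Type} [CommRing R] [IsLocalRing R] [IsNoetherianRing R] {C : Type}
    [AddCommGroup C] [Module R C] [Module.Finite R C] [Nontrivial C]
    {P : ℕ → ModuleCat.{0} R} {d : ∀ n, ↥(P (n + 1)) →ₗ[R] ↥(P n)} {ε : P 0 →ₗ[R] C}
    (hfin : ∀ n, Module.Finite R (P n))
    (hproj : ∀ n, Module.Projective R (P n))
    (hε : Function.Surjective ε) (h0 : Function.Exact (d 0) ε)
    (hd : ∀ n, Function.Exact (d (n + 1)) (d n))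
    (hb : Function.Bijective (fun r : R => (r • LinearMap.id : C →ₗ[R] C)))
    (hC : EV d C) (k : ℕ) (hpd : PdLE R k (LinearMap.range (d 0))) : Nonempty (C ≃ₗ[R] R) := by
  classical
  have hext : ∀ n, ∀ f : LinearMap.range (d n) →ₗ[R] C, ∃ g : P n →ₗ[R] C,
      g ∘ₗ (LinearMap.range (d n)).subtype = f := by
    intro n f
    obtain ⟨g, hg⟩ := hC n (f ∘ₗ (d n).rangeRestrict) (by
      ext x
      have : (d n).rangeRestrict (d (n+1) x) = 0 := Subtype.ext ((hd n).apply_apply_eq_zero x)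
      simp [this])
    refine ⟨g, ?_⟩
    ext ⟨x, y, rfl⟩
    exact LinearMap.congr_fun hg y
  obtain ⟨N, hN⟩ := exists_proj_syzygy hproj hd k 0 hpd
  have hrange0 : Module.Projective R (LinearMap.range (d 0)) := by
    induction N with
    | zero => exact hN
    | succ N ih =>
      apply ih
      have := hproj (N+1)
      have := hfin (N+1)
      refine desc_step (C := C) (P := P (N+1)) (Z := LinearMap.range (d (N+1)))
        (LinearMap.range (d (N+1))).subtype (d N).rangeRestrict
        (Submodule.subtype_injective _) (LinearMap.surjective_rangeRestrict _) ?_ (hext (N+1))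
      intro x
      rw [← Subtype.val_inj]
      change d N x = 0 ↔ _
      rw [hd N x]
      simp
  have hCproj : Module.Projective R C := by
    have := hproj 0
    have := hfin 0
    refine desc_step (C := C) (P := P 0) (Z := LinearMap.range (d 0))
        (LinearMap.range (d 0)).subtype ε
        (Submodule.subtype_injective _) hε ?_ (hext 0)
    intro x
    rw [h0 x]
    simp
  have := Module.free_of_flat_of_isLocalRing (R := R) (P := C)
  let b := Module.Free.chooseBasis R C
  obtain ⟨j⟩ : Nonempty (Module.Free.ChooseBasisIndex R C) := b.index_nonempty
  have hsub : ∀ l, l = j := by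
    intro l
    by_contra hl
    obtain ⟨r, hr⟩ := hb.2 (LinearMap.toSpanSingleton R C (b j) ∘ₗ b.coord j)
    have h1 := congrArg (fun c => b.repr c l) (LinearMap.congr_fun hr (b l))
    have h2 := congrArg (fun c => b.repr c j) (LinearMap.congr_fun hr (b j))
    simp [Finsupp.single_apply, hl] at h1 h2
    rw [h1] at h2
    exact zero_ne_one h2
  let _ : Unique (Module.Free.ChooseBasisIndex R C) := ⟨⟨j⟩, hsub⟩
  exact ⟨b.repr.trans (Finsupp.LinearEquiv.finsuppUnique R R _)⟩

lemma bounded_of_pd {R : Type} [CommRing R] {C : Type} [AddCommGroup C] [Module R C]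
    (e : C ≃ₗ[R] R) (n : ℕ) : ∀ (M : Type) [AddCommGroup M] [Module R M],
    PdLE R n M → HasBoundedExactCRes R C M n := by
  have E : ∀ (Q : Type) [AddCommGroup Q] [Module R Q], Nonempty (C ⊗[R] Q ≃ₗ[R] Q) :=
    fun Q _ _ => ⟨(TensorProduct.congr e (LinearEquiv.refl R Q)).trans (TensorProduct.lid R Q)⟩
  induction n with
  | zero =>
    intro M _ _ h
    rw [pdLE_zero] at h
    obtain ⟨eM⟩ := E M
    have hsub : ∀ i : ℕ, 0 < i → Subsingleton (C ⊗[R] ↥((fun i => match i with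
        | 0 => ModuleCat.of R M
        | _ + 1 => ModuleCat.of R PUnit : ℕ → ModuleCat.{0} R) i)) := by
      intro i hi
      rcases i with _ | i
      · omega
      · obtain ⟨e'⟩ := E PUnit
        exact e'.toEquiv.subsingleton
    refine ⟨fun i => match i with
        | 0 => ModuleCat.of R M
        | _ + 1 => ModuleCat.of R PUnit, fun i => 0, eM.toLinearMap, ?_, ⟨?_, ?_, ?_⟩, hsub⟩
    · rintro (_ | i)
      · exact h
      · exact (inferInstance : Module.Projective R PUnit)
    · exact eM.surjective
    · intro x
      constructor
      · intro hx
        exact ⟨0, (eM.injective (hx.trans (map_zero eM).symm)).symm⟩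
      · rintro ⟨y, rfl⟩
        exact map_zero _
    · intro i x
      have := hsub (i+1) (by omega)
      exact ⟨fun _ => ⟨0, Subsingleton.elim _ _⟩, fun _ => rfl⟩
  | succ n ih =>
    intro M _ _ h
    let f : (M →₀ R) →ₗ[R] M := Finsupp.linearCombination R id
    have hf : Function.Surjective f := Finsupp.linearCombination_id_surjective R M
    have h1 : PdLE R (n+1) M ↔ PdLE R n (LinearMap.ker f) :=
      pdLE_succ (Submodule.subtype_injective _) hf (exact_ker_subtype f)
    obtain ⟨Q, δ, η, hQ, ⟨hη, hδη, hδ⟩, hs⟩ := ih _ (h1.1 h)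
    obtain ⟨eF⟩ := E (M →₀ R)
    refine ⟨fun i => match i with
        | 0 => ModuleCat.of R (M →₀ R)
        | i + 1 => Q i, fun i => match i with
        | 0 => eF.symm.toLinearMap ∘ₗ (LinearMap.ker f).subtype ∘ₗ η
        | i + 1 => δ i, f ∘ₗ eF.toLinearMap, ?_, ⟨?_, ?_, ?_⟩, ?_⟩
    · rintro (_ | i)
      · exact (inferInstance : Module.Projective R (M →₀ R))
      · exact hQ i
    · exact hf.comp eF.surjective
    · intro x
      constructor
      · intro hx
        obtain ⟨y, hy⟩ := hη ⟨eF x, hx⟩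
        refine ⟨y, ?_⟩
        change eF.symm (η y : M →₀ R) = x
        rw [hy]; exact eF.symm_apply_apply x
      · rintro ⟨y, rfl⟩
        change f (eF (eF.symm (η y : M →₀ R))) = 0
        rw [eF.apply_symm_apply]
        exact (η y).2
    · rintro (_ | i)
      · intro x
        rw [← hδη x]
        change eF.symm (η x : M →₀ R) = 0 ↔ _
        rw [LinearEquiv.map_eq_zero_iff, Submodule.coe_eq_zero]
      · exact hδ i
    · rintro (_ | i) hi
      · omega
      · exact hs i (by omega)

end

/-- Over a noetherian local ring `(R, m, k)` with a semidualizing module `C`,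
the following are equivalent: every module has finite `P_C`-projective dimension;
`k` has finite `P_C`-projective dimension; `R` is regular (its maximal ideal is
generated by `Krull dim R` elements). -/
theorem finCPd_all_iff_regular
    (R : Type) [CommRing R] [IsNoetherianRing R] [IsLocalRing R]
    (C : Type) [AddCommGroup C] [Module R C] (hC : IsSemidualizing R C) :
    ((∀ (M : Type) [AddCommGroup M] [Module R M], HasFinCPd R C M) ↔
      (∃ s : Finset R, Ideal.span (s : Set R) = IsLocalRing.maximalIdeal R ∧
        (s.card : WithBot ℕ∞) = ringKrullDim R)) ∧
    (HasFinCPd R C (IsLocalRing.ResidueField R) ↔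
      (∃ s : Finset R, Ideal.span (s : Set R) = IsLocalRing.maximalIdeal R ∧
        (s.card : WithBot ℕ∞) = ringKrullDim R)) := by
  obtain ⟨⟨P, d, ε, hfin, hproj, hε, h0, hd⟩, hb, hext⟩ := hC
  have hCfin : Module.Finite R C := by
    have := hfin 0
    exact Module.Finite.of_surjective ε hε
  have hCnt : Nontrivial C := by
    by_contra h
    rw [not_nontrivial_iff_subsingleton] at h
    have h1 : (1 : R) = 0 := hb.1 (Subsingleton.elim _ _)
    exact one_ne_zero h1
  have hEV : EV d C := fun n f hf =>
    factor_of_ext P d ε h0 hd hproj hε C n (hext (n + 1) (by omega)) f hf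
  have h23 : HasFinCPd R C (IsLocalRing.ResidueField R) → ∃ e, RegN R e := by
    rintro ⟨n, hn⟩
    have h1 := (hom_pd hfin hproj hε h0 hd hb hEV n _ hn).2
    obtain ⟨D, hD⟩ := exists_dim R
    exact reg_of_pd D R hD n (pd_residue_of_hom R C n h1)
  have h31 : (∃ e, RegN R e) → ∀ (M : Type) [AddCommGroup M] [Module R M], HasFinCPd R C M := by
    rintro ⟨e, he⟩ M _ _
    have hpd := pd_all_of_regN e R he
    obtain ⟨eq⟩ := C_equiv_R hfin hproj hε h0 hd hb hEV e (hpd _)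
    exact ⟨e, bounded_of_pd eq e M (hpd M)⟩
  rw [regN_iff]
  exact ⟨⟨fun h => h23 (h _), fun h => h31 h⟩, ⟨h23, fun h => h31 h _⟩⟩

end
end

section
/- Let R be a commutative ring and C a semidualizing R-module. Then R is noetherian if and only if the class of C-injective R-modules is closed under arbitrary direct sums; that is, if and only if for every family (I_λ) of injective R-modules there exists an injective R-module J with ⊕_λ Hom_R(C, I_λ) ≅ Hom_R(C, J). -/
open TensorProduct CategoryTheory

noncomputable section

theorem aux_finite_supp {R : Type} [CommRing R] {M : Type} [AddCommGroup M] [Module R M]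
    [Module.Finite R M] {ι : Type} {E : ι → Type} [∀ l, AddCommGroup (E l)]
    [∀ l, Module R (E l)] (g : M →ₗ[R] DirectSum ι E) :
    ∃ T : Finset ι, ∀ m, ∀ l, l ∉ T → g m l = 0 := by
  classical
  obtain ⟨S, hS⟩ := (Module.Finite.fg_top : (⊤ : Submodule R M).FG)
  refine ⟨S.biUnion fun s => DFinsupp.support (g s), fun m l hl => ?_⟩
  have hm : m ∈ Submodule.span R (S : Set M) := hS ▸ Submodule.mem_top
  have key : Submodule.span R (S : Set M) ≤
      LinearMap.ker ((DirectSum.component R ι E l).comp g) := by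
    rw [Submodule.span_le]
    intro s hs
    by_contra h
    exact hl (Finset.mem_biUnion.2 ⟨s, hs, DFinsupp.mem_support_iff.2 h⟩)
  exact key hm

theorem aux_sum_eq {R : Type} [CommRing R] {ι : Type} [DecidableEq ι] {E : ι → Type}
    [∀ l, AddCommGroup (E l)] [∀ l, Module R (E l)] (x : DirectSum ι E) (T : Finset ι)
    (h : ∀ l, l ∉ T → x l = 0) :
    ∑ l ∈ T, DirectSum.lof R ι E l (x l) = x := by
  refine DFinsupp.ext fun j => ?_
  have h1 : (∑ l ∈ T, DirectSum.lof R ι E l (x l)) j =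
      ∑ l ∈ T, (DirectSum.lof R ι E l (x l)) j :=
    map_sum (DirectSum.component R ι E j) _ _
  refine h1.trans ?_
  by_cases hj : j ∈ T
  · rw [Finset.sum_eq_single j]
    · exact DirectSum.lof_apply R j (x j)
    · intro l _ hl
      exact DirectSum.of_eq_of_ne _ _ _ hl.symm
    · exact fun h => absurd hj h
  · rw [Finset.sum_eq_zero, h j hj]
    intro l hl
    exact DirectSum.of_eq_of_ne _ _ _ (fun h => hj (h ▸ hl))

theorem aux_directSum_injective {R : Type} [CommRing R] [IsNoetherianRing R] {ι : Type}
    {E : ι → Type} [∀ l, AddCommGroup (E l)] [∀ l, Module R (E l)]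
    (hE : ∀ l, Module.Injective R (E l)) : Module.Injective R (DirectSum ι E) := by
  classical
  apply Module.Baer.injective
  intro I g
  obtain ⟨T, hT⟩ := aux_finite_supp g
  choose e he using fun l => Module.Baer.of_injective (hE l) I ((DirectSum.component R ι E l).comp g)
  refine ⟨∑ l ∈ T, (DirectSum.lof R ι E l).comp (e l), fun x hx => ?_⟩
  rw [LinearMap.sum_apply, ← aux_sum_eq (R := R) (g ⟨x, hx⟩) T (hT _)]
  refine Finset.sum_congr rfl fun l _ => ?_
  rw [LinearMap.comp_apply, he l x hx]
  rfl

/-- The natural map from the sum of Homs to Hom into the sum. -/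
def auxSumHom (R : Type) [CommRing R] (C : Type) [AddCommGroup C] [Module R C]
    (ι : Type) [DecidableEq ι] (E : ι → Type) [∀ l, AddCommGroup (E l)]
    [∀ l, Module R (E l)] :
    DirectSum ι (fun l => C →ₗ[R] E l) →ₗ[R] (C →ₗ[R] DirectSum ι E) :=
  DirectSum.toModule R ι _ (fun l => LinearMap.compRight R (DirectSum.lof R ι E l))

theorem auxSumHom_apply (R : Type) [CommRing R] (C : Type) [AddCommGroup C] [Module R C]
    (ι : Type) [DecidableEq ι] (E : ι → Type) [∀ l, AddCommGroup (E l)]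
    [∀ l, Module R (E l)] (x : DirectSum ι (fun l => C →ₗ[R] E l)) (c : C) (j : ι) :
    auxSumHom R C ι E x c j = x j c := by
  have : (DirectSum.component R ι E j).comp ((LinearMap.applyₗ c).comp (auxSumHom R C ι E)) =
      (LinearMap.applyₗ c).comp (DirectSum.component R ι (fun l => C →ₗ[R] E l) j) := by
    refine DirectSum.linearMap_ext R fun l => ?_
    ext f
    simp only [LinearMap.comp_apply, auxSumHom, DirectSum.toModule_lof, LinearMap.applyₗ_apply_apply,
      LinearMap.compRight_apply]
    by_cases h : l = j
    · subst h
      simp [DirectSum.component.lof_self]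
    · rw [DirectSum.component.of, DirectSum.component.of]
      simp [h]
  exact LinearMap.congr_fun this x

theorem auxSumHom_bijective (R : Type) [CommRing R] (C : Type) [AddCommGroup C] [Module R C]
    [Module.Finite R C]
    (ι : Type) [DecidableEq ι] (E : ι → Type) [∀ l, AddCommGroup (E l)]
    [∀ l, Module R (E l)] : Function.Bijective (auxSumHom R C ι E) := by
  constructor
  · intro x y hxy
    refine DFinsupp.ext fun j => LinearMap.ext fun c => ?_
    have := auxSumHom_apply R C ι E x c j
    rw [hxy, auxSumHom_apply] at this
    exact this.symm
  · intro g
    obtain ⟨T, hT⟩ := aux_finite_supp g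
    refine ⟨∑ l ∈ T, DirectSum.lof R ι (fun l => C →ₗ[R] E l) l
      ((DirectSum.component R ι E l).comp g), ?_⟩
    ext1 c
    rw [← aux_sum_eq (R := R) (g c) T (hT c), map_sum, LinearMap.sum_apply]
    refine Finset.sum_congr rfl fun l _ => ?_
    rw [auxSumHom, DirectSum.toModule_lof]
    rfl

/-- `A ⊗ Hom(B,I) → Hom(Hom(A,B),I)`. -/
def auxTheta (R : Type) [CommRing R] (A B I : Type) [AddCommGroup A] [Module R A]
    [AddCommGroup B] [Module R B] [AddCommGroup I] [Module R I] :
    (A ⊗[R] (B →ₗ[R] I)) →ₗ[R] ((A →ₗ[R] B) →ₗ[R] I) :=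
  TensorProduct.lift
    (LinearMap.mk₂ R (fun a f => f.comp (LinearMap.applyₗ a : (A →ₗ[R] B) →ₗ[R] B))
      (fun a b f => by ext g; simp) (fun r a f => by ext g; simp)
      (fun a f f' => by ext g; simp) (fun r a f => by ext g; simp))

theorem auxTheta_tmul (R : Type) [CommRing R] (A B I : Type) [AddCommGroup A] [Module R A]
    [AddCommGroup B] [Module R B] [AddCommGroup I] [Module R I] (a : A) (f : B →ₗ[R] I)
    (g : A →ₗ[R] B) : auxTheta R A B I (a ⊗ₜ f) g = f (g a) := by
  simp [auxTheta]

theorem auxTheta_free (R : Type) [CommRing R] (n : ℕ) (B I : Type)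
    [AddCommGroup B] [Module R B] [AddCommGroup I] [Module R I] :
    Function.Bijective (auxTheta R (Fin n → R) B I) := by
  let s : Fin n → (B →ₗ[R] ((Fin n → R) →ₗ[R] B)) := fun i =>
    LinearMap.mk₂ R (fun b x => x i • b) (fun b b' x => smul_add _ _ _)
      (fun r b x => smul_comm _ _ _) (fun b x y => by simp [add_smul])
      (fun r b x => by simp [mul_smul])
  have hs : ∀ i b x, s i b x = x i • b := fun i b x => by simp [s]
  let inv : (((Fin n → R) →ₗ[R] B) →ₗ[R] I) → (Fin n → R) ⊗[R] (B →ₗ[R] I) := fun φ =>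
    ∑ i, (Pi.single i (1 : R) : Fin n → R) ⊗ₜ (φ.comp (s i))
  have hadd : ∀ a b, inv (a + b) = inv a + inv b := fun a b => by
    simp [inv, LinearMap.add_comp, TensorProduct.tmul_add, Finset.sum_add_distrib]
  refine Function.bijective_iff_has_inverse.2 ⟨inv, ?_, ?_⟩
  · intro t
    induction t with
    | zero => simp [inv]
    | add a b ha hb => rw [map_add, hadd, ha, hb]
    | tmul x f =>
      have : ∀ i, (auxTheta R (Fin n → R) B I (x ⊗ₜ f)).comp (s i) = x i • f := by
        intro i
        ext b
        simp [auxTheta_tmul, hs]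
      simp only [inv, this]
      simp only [← TensorProduct.smul_tmul, ← TensorProduct.sum_tmul]
      congr 1
      ext j
      simp [Finset.sum_apply, Pi.single_apply]
  · intro φ
    ext g
    simp only [inv, map_sum, LinearMap.sum_apply, auxTheta_tmul, LinearMap.comp_apply]
    rw [← map_sum]
    congr 1
    refine LinearMap.ext fun x => ?_
    simp only [LinearMap.sum_apply, hs]
    conv_rhs => rw [pi_eq_sum_univ' x]
    simp [map_sum]

theorem auxTheta_bijective (R : Type) [CommRing R] (A B I : Type) [AddCommGroup A] [Module R A]
    [AddCommGroup B] [Module R B] [AddCommGroup I] [Module R I] [Module.FinitePresentation R A]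
    [hI : Module.Injective R I] : Function.Bijective (auxTheta R A B I) := by
  obtain ⟨n, m, f, g, hf, hfg⟩ := Module.FinitePresentation.exists_fin' R A
  have nat : ∀ (X Y : Type) [AddCommGroup X] [Module R X] [AddCommGroup Y] [Module R Y]
      (u : X →ₗ[R] Y), (LinearMap.lcomp R I (LinearMap.lcomp R B u)).comp (auxTheta R X B I) =
        (auxTheta R Y B I).comp (u.rTensor (B →ₗ[R] I)) := by
    intro X Y _ _ _ _ u
    ext x h k
    simp [auxTheta_tmul]
  -- Hom(-, I) is exact
  have hlift : ∀ (X Y : Type) [AddCommGroup X] [Module R X] [AddCommGroup Y] [Module R Y]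
      (u : X →ₗ[R] Y), Function.Injective u → ∀ w : X →ₗ[R] I, ∃ v : Y →ₗ[R] I, v.comp u = w := by
    intro X Y _ _ _ _ u hu w
    obtain ⟨v, hv⟩ := hI.out u hu w
    exact ⟨v, LinearMap.ext hv⟩
  have hinj : Function.Injective (LinearMap.lcomp R B f) := by
    intro a b hab
    ext x
    obtain ⟨y, rfl⟩ := hf x
    exact LinearMap.congr_fun hab y
  refine LinearMap.bijective_of_surjective_of_bijective_of_right_exact
    (g.rTensor (B →ₗ[R] I)) (f.rTensor (B →ₗ[R] I))
    (LinearMap.lcomp R I (LinearMap.lcomp R B g)) (LinearMap.lcomp R I (LinearMap.lcomp R B f))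
    (auxTheta R _ B I) (auxTheta R _ B I) (auxTheta R A B I) (nat _ _ g) (nat _ _ f)
    (rTensor_exact _ hfg hf) ?_ (auxTheta_free R m B I).2 (auxTheta_free R n B I)
    (LinearMap.rTensor_surjective _ hf) ?_
  · intro φ
    constructor
    · intro hφ
      -- φ vanishes on the kernel of `lcomp g`
      have hk : LinearMap.ker (LinearMap.lcomp R B g) ≤ LinearMap.ker φ := by
        intro k hk
        have hk' : ∀ x, k (g x) = 0 := fun x => LinearMap.congr_fun hk x
        have : ∃ k' : A →ₗ[R] B, k'.comp f = k := by
          have hle : LinearMap.ker f ≤ LinearMap.ker k := by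
            intro x hx
            obtain ⟨y, rfl⟩ := (hfg x).1 hx
            exact hk' y
          refine ⟨((LinearMap.ker f).liftQ k hle).comp
            (f.quotKerEquivOfSurjective hf).symm.toLinearMap, ?_⟩
          refine LinearMap.ext fun x => ?_
          have : (f.quotKerEquivOfSurjective hf).symm (f x) = Submodule.Quotient.mk x := by
            rw [LinearEquiv.symm_apply_eq]; rfl
          simp only [LinearMap.comp_apply, LinearEquiv.coe_coe, this]
          rfl
        obtain ⟨k', rfl⟩ := this
        exact LinearMap.congr_fun hφ k'
      let u := (LinearMap.ker (LinearMap.lcomp R B g)).liftQ (LinearMap.lcomp R B g) le_rfl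
      have hu : Function.Injective u := by
        rw [← LinearMap.ker_eq_bot]
        exact Submodule.ker_liftQ_eq_bot _ _ _ le_rfl
      obtain ⟨v, hv⟩ := hlift _ _ u hu ((LinearMap.ker (LinearMap.lcomp R B g)).liftQ φ hk)
      refine ⟨v, ?_⟩
      ext1 k
      exact LinearMap.congr_fun hv (Submodule.Quotient.mk k)
    · rintro ⟨v, rfl⟩
      ext1 k
      have : (k.comp f).comp g = 0 := by
        refine LinearMap.ext fun x => ?_
        simp [hfg.apply_apply_eq_zero]
      change v ((k.comp f).comp g) = 0
      rw [this, map_zero]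
  · intro w
    exact hlift _ _ _ hinj w

theorem aux_evalNu_bijective (R : Type) [CommRing R] (C : Type) [AddCommGroup C] [Module R C]
    [Module.FinitePresentation R C]
    (hb : Function.Bijective (fun r : R => (r • LinearMap.id : C →ₗ[R] C)))
    (I : Type) [AddCommGroup I] [Module R I] [Module.Injective R I] :
    Function.Bijective (evalNu R C I) := by
  let h : R →ₗ[R] (C →ₗ[R] C) := LinearMap.toSpanSingleton R _ LinearMap.id
  let e : R ≃ₗ[R] (C →ₗ[R] C) := LinearEquiv.ofBijective h hb
  let E : ((C →ₗ[R] C) →ₗ[R] I) ≃ₗ[R] I :=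
    (LinearEquiv.congrLeft I R e.symm).trans (LinearMap.ringLmapEquivSelf R R I)
  have : evalNu R C I = E.toLinearMap.comp (auxTheta R C C I) := by
    ext c f
    have : e 1 = LinearMap.id := one_smul R (LinearMap.id : C →ₗ[R] C)
    simp [evalNu, E, LinearEquiv.congrLeft, auxTheta_tmul, this]
  rw [this]
  exact E.bijective.comp (auxTheta_bijective R C C I)

theorem aux_bass (R : Type) [CommRing R]
    (H : ∀ (ι : Type) (I : ι → ModuleCat.{0} R), (∀ l, Module.Injective R ↥(I l)) →
      Module.Injective R (DirectSum ι (fun l => ↥(I l)))) : IsNoetherianRing R := by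
  classical
  rw [isNoetherianRing_iff, ← monotone_stabilizes_iff_noetherian]
  intro a
  have hemb : ∀ n, ∃ (E : ModuleCat.{0} R) (j : (R ⧸ a n) →ₗ[R] E), Module.Injective R E ∧
      Function.Injective j := by
    intro n
    obtain ⟨P⟩ := EnoughInjectives.presentation (ModuleCat.of R (R ⧸ a n))
    have hPJ : CategoryTheory.Injective (ModuleCat.of R P.J) := P.injective
    exact ⟨P.J, P.f.hom, Module.injective_module_of_injective_object R P.J,
      (ModuleCat.mono_iff_injective _).1 P.mono⟩
  choose E j hE hj using hemb
  have hinj := H ℕ E hE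
  let q : ∀ n, R →ₗ[R] E n := fun n => (j n).comp (a n).mkQ
  have hq : ∀ n x, q n x = 0 ↔ x ∈ a n := by
    intro n x
    simp only [q, LinearMap.comp_apply]
    rw [map_eq_zero_iff _ (hj n)]
    exact Submodule.Quotient.mk_eq_zero _
  let I : Ideal R := ⨆ n, a n
  have hI : ∀ x ∈ I, ∃ n, x ∈ a n := fun x hx =>
    (Submodule.mem_iSup_of_directed _ a.monotone.directed_le).1 hx
  choose N hN using fun x : I => hI x.1 x.2
  let gf : I → DirectSum ℕ (fun n => ↥(E n)) := fun x =>
    DirectSum.mk (fun n => ↥(E n)) (Finset.range (N x)) (fun n => q n x)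
  have hgf : ∀ x n, gf x n = q n x := by
    intro x n
    by_cases hn : n ∈ Finset.range (N x)
    · exact DirectSum.mk_apply_of_mem hn
    · refine (DirectSum.mk_apply_of_notMem hn).trans ((hq n x).2 ?_).symm
      exact a.monotone (by simpa using hn) (hN x)
  let g : I →ₗ[R] DirectSum ℕ (fun n => ↥(E n)) :=
    { toFun := gf
      map_add' := fun x y => DFinsupp.ext fun n => by
        rw [DirectSum.add_apply]
        simp only [hgf]; simp
      map_smul' := fun r x => DFinsupp.ext fun n => by
        rw [RingHom.id_apply, DirectSum.smul_apply]
        simp only [hgf]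
        exact map_smul (q n) r x.1 }
  obtain ⟨G, hG⟩ := Module.Baer.of_injective hinj I g
  obtain ⟨n, hn⟩ := Infinite.exists_notMem_finset (DFinsupp.support (G 1))
  have hG1 : G 1 n = 0 := DFinsupp.notMem_support_iff.1 hn
  have hle : I ≤ a n := by
    intro x hx
    rw [← hq, ← hgf ⟨x, hx⟩ n]
    have : gf ⟨x, hx⟩ = x • G 1 := by
      rw [← map_smul, smul_eq_mul, mul_one]
      exact (hG x hx).symm
    rw [this, DirectSum.smul_apply, hG1, smul_zero]
  exact ⟨n, fun m hm => le_antisymm (a.monotone hm) ((le_iSup a m).trans hle)⟩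

/-- `R` is noetherian iff the class of `C`-injective modules is closed under arbitrary
direct sums: for every family of injective modules `(I_λ)` there is an injective module
`J` with `⨁ Hom_R(C, I_λ) ≅ Hom_R(C, J)`. -/
theorem noetherian_iff_cInjectives_closed_under_directSum
    (R : Type) [CommRing R] (C : Type) [AddCommGroup C] [Module R C]
    (hC : IsSemidualizing R C) :
    IsNoetherianRing R ↔
      ∀ (ι : Type) (I : ι → ModuleCat.{0} R), (∀ l, Module.Injective R ↥(I l)) →
        ∃ J : ModuleCat.{0} R, Module.Injective R ↥J ∧
          Nonempty ((DirectSum ι (fun l => C →ₗ[R] ↥(I l))) ≃ₗ[R] (C →ₗ[R] ↥J)) := by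
  obtain ⟨⟨P, d, ε, hfin, hproj, hε, hex, -⟩, hb, -⟩ := hC
  have hfp : Module.FinitePresentation R C := by
    have := hfin 0
    have := hproj 0
    have := hfin 1
    have : Module.FinitePresentation R (P 0) := Module.finitePresentation_of_projective R _
    refine Module.finitePresentation_of_surjective ε hε ?_
    rw [LinearMap.exact_iff.1 hex]
    exact Submodule.fg_range _
  classical
  constructor
  · intro hR ι I hI
    exact ⟨ModuleCat.of R (DirectSum ι (fun l => ↥(I l))), aux_directSum_injective hI,
      ⟨LinearEquiv.ofBijective _ (auxSumHom_bijective R C ι (fun l => ↥(I l)))⟩⟩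
  · intro H
    refine aux_bass R fun ι I hI => ?_
    obtain ⟨J, hJ, ⟨e⟩⟩ := H ι I hI
    let e1 : (C ⊗[R] DirectSum ι (fun l => C →ₗ[R] ↥(I l))) ≃ₗ[R] ↥J :=
      (TensorProduct.congr (LinearEquiv.refl R C) e).trans
        (LinearEquiv.ofBijective _ (aux_evalNu_bijective R C hb J))
    let e2 : (C ⊗[R] DirectSum ι (fun l => C →ₗ[R] ↥(I l))) ≃ₗ[R]
        DirectSum ι (fun l => ↥(I l)) :=
      (TensorProduct.directSumRight R R C (fun l => C →ₗ[R] ↥(I l))).trans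
        (DFinsupp.mapRange.linearEquiv fun l =>
          have := hI l
          LinearEquiv.ofBijective _ (aux_evalNu_bijective R C hb (I l)))
    exact (Module.Baer.of_equiv (e1.symm.trans e2) (Module.Baer.of_injective hJ)).injective
end
end
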